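/- Let w ∈ W. The orbit X = Kw (which is a real algebraic subset of W) is K-reduced if and only if Kw is a principal orbit, and X = Kw is almost K-reduced if and only if Kw is an almost principal orbit. -/

import Mathlib

/-!
Common framework: a "compact Lie group / complex reductive group acting on a
finite-dimensional module" is modelled as a subgroup of invertible `n × n`
matrices over `𝕜 = ℝ` or `ℂ` acting on `Fin n → 𝕜` by `Matrix.mulVec`.
Polynomial functions on the module are `MvPolynomial (Fin n) 𝕜`.
-/

set_option synthInstance.maxHeartbeats 1000000
set_option maxHeartbeats 1000000

noncomputable section

open MvPolynomial

namespace ZPaper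

variable (𝕜 : Type) [RCLike 𝕜] (n : ℕ)

/-- The zero set of a family of polynomials. -/
def zeroSet (S : Set (MvPolynomial (Fin n) 𝕜)) : Set (Fin n → 𝕜) :=
  {v | ∀ p ∈ S, eval v p = 0}

/-- A subset of `𝕜ⁿ` is algebraic if it is the zero set of a family of polynomials. -/
def IsAlgebraicSet (X : Set (Fin n → 𝕜)) : Prop :=
  ∃ S : Set (MvPolynomial (Fin n) 𝕜), X = zeroSet 𝕜 n S

/-- The vanishing ideal `I(X)` of a subset `X ⊆ 𝕜ⁿ`. -/
def vanishingIdeal (X : Set (Fin n → 𝕜)) : Ideal (MvPolynomial (Fin n) 𝕜) where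
  carrier := {p | ∀ x ∈ X, eval x p = 0}
  zero_mem' := by intro x _; simp
  add_mem' := by intro a b ha hb x hx; simp [ha x hx, hb x hx]
  smul_mem' := by intro c p hp x hx; simp [smul_eq_mul, hp x hx]

/-- The Zariski closure of a subset of `𝕜ⁿ`. -/
def zclosure (A : Set (Fin n → 𝕜)) : Set (Fin n → 𝕜) :=
  zeroSet 𝕜 n (vanishingIdeal 𝕜 n A : Set (MvPolynomial (Fin n) 𝕜))

/-- `A` is Zariski dense in `X`: every polynomial vanishing on `A` vanishes on `X`. -/
def ZDenseIn (A X : Set (Fin n → 𝕜)) : Prop :=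
  ∀ p : MvPolynomial (Fin n) 𝕜, (∀ a ∈ A, eval a p = 0) → ∀ x ∈ X, eval x p = 0

/-- A set of matrices is a subgroup of `GL_n(𝕜)`. -/
def IsMatSubgroup (G : Set (Matrix (Fin n) (Fin n) 𝕜)) : Prop :=
  (1 : Matrix (Fin n) (Fin n) 𝕜) ∈ G ∧ (∀ a ∈ G, ∀ b ∈ G, a * b ∈ G) ∧
    ∀ a ∈ G, IsUnit a ∧ a⁻¹ ∈ G

/-- `X` is a `G`-stable subset of `𝕜ⁿ`. -/
def Stabilizes (G : Set (Matrix (Fin n) (Fin n) 𝕜)) (X : Set (Fin n → 𝕜)) : Prop :=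
  ∀ g ∈ G, ∀ x ∈ X, Matrix.mulVec g x ∈ X

/-- A polynomial is `G`-invariant. -/
def Invariant (G : Set (Matrix (Fin n) (Fin n) 𝕜)) (p : MvPolynomial (Fin n) 𝕜) : Prop :=
  ∀ g ∈ G, ∀ v : Fin n → 𝕜, eval (Matrix.mulVec g v) p = eval v p

/-- `I_G(X)`: the ideal generated by the `G`-invariant polynomials vanishing on `X`,
i.e. by `I(X)^G = I(X) ∩ 𝕜[V]^G`. -/
def invariantIdeal (G : Set (Matrix (Fin n) (Fin n) 𝕜)) (X : Set (Fin n → 𝕜)) :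
    Ideal (MvPolynomial (Fin n) 𝕜) :=
  Ideal.span {p | Invariant 𝕜 n G p ∧ ∀ x ∈ X, eval x p = 0}

/-- `X` is `G`-reduced: `I_G(X) = I(X)`. -/
def IsGReduced (G : Set (Matrix (Fin n) (Fin n) 𝕜)) (X : Set (Fin n → 𝕜)) : Prop :=
  invariantIdeal 𝕜 n G X = vanishingIdeal 𝕜 n X

/-- `X` is almost `G`-reduced: `√I_G(X) = I(X)`. -/
def IsAlmostGReduced (G : Set (Matrix (Fin n) (Fin n) 𝕜)) (X : Set (Fin n → 𝕜)) : Prop :=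
  (invariantIdeal 𝕜 n G X).radical = vanishingIdeal 𝕜 n X

/-- The orbit `G·v`. -/
def orbit (G : Set (Matrix (Fin n) (Fin n) 𝕜)) (v : Fin n → 𝕜) : Set (Fin n → 𝕜) :=
  (fun g => Matrix.mulVec g v) '' G

/-- The isotropy group `G_v`. -/
def isotropy (G : Set (Matrix (Fin n) (Fin n) 𝕜)) (v : Fin n → 𝕜) :
    Set (Matrix (Fin n) (Fin n) 𝕜) :=
  {g ∈ G | Matrix.mulVec g v = v}

/-- Matrix exponential. -/
def mexp (A : Matrix (Fin n) (Fin n) 𝕜) : Matrix (Fin n) (Fin n) 𝕜 :=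
  ∑' k : ℕ, ((k.factorial : 𝕜)⁻¹) • A ^ k

/-- The Lie algebra of a matrix group: matrices whose one-parameter subgroup lies in `G`. -/
def lieAlgebra (G : Set (Matrix (Fin n) (Fin n) 𝕜)) : Set (Matrix (Fin n) (Fin n) 𝕜) :=
  {A | ∀ t : 𝕜, mexp 𝕜 n (t • A) ∈ G}

/-- The tangent space `T_v(G·v)` to the orbit, i.e. `𝔤·v`. -/
def orbitTangent (G : Set (Matrix (Fin n) (Fin n) 𝕜)) (v : Fin n → 𝕜) :
    Submodule 𝕜 (Fin n → 𝕜) :=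
  Submodule.span 𝕜 ((fun A => Matrix.mulVec A v) '' lieAlgebra 𝕜 n G)

/-- `N` is a `G_v`-stable complement to `T_v(G·v)` in `𝕜ⁿ` (a slice at `v`). -/
def IsSliceComplement (G : Set (Matrix (Fin n) (Fin n) 𝕜)) (v : Fin n → 𝕜)
    (N : Submodule 𝕜 (Fin n → 𝕜)) : Prop :=
  IsCompl (orbitTangent 𝕜 n G v) N ∧
    ∀ g ∈ isotropy 𝕜 n G v, ∀ x ∈ N, Matrix.mulVec g x ∈ N

/-- The image of `H` in `GL(N)` is trivial. -/
def ActsTriviallyOn (H : Set (Matrix (Fin n) (Fin n) 𝕜))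
    (N : Submodule 𝕜 (Fin n → 𝕜)) : Prop :=
  ∀ g ∈ H, ∀ x ∈ N, Matrix.mulVec g x = x

/-- The image of `H` in `GL(N)` is finite. -/
def HasFiniteImageOn (H : Set (Matrix (Fin n) (Fin n) 𝕜))
    (N : Submodule 𝕜 (Fin n → 𝕜)) : Prop :=
  Set.Finite ((fun g => fun x : N => Matrix.mulVec g (x : Fin n → 𝕜)) '' H)

/-- The orbit `G·v` is (Zariski) closed. -/
def HasClosedOrbit (G : Set (Matrix (Fin n) (Fin n) 𝕜)) (v : Fin n → 𝕜) : Prop :=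
  zclosure 𝕜 n (orbit 𝕜 n G v) ⊆ orbit 𝕜 n G v

/-- `v` lies on a principal orbit: `G·v` is closed and the isotropy group acts trivially on
some (hence any) slice at `v`. -/
def IsPrincipalPt (G : Set (Matrix (Fin n) (Fin n) 𝕜)) (v : Fin n → 𝕜) : Prop :=
  HasClosedOrbit 𝕜 n G v ∧
    ∃ N, IsSliceComplement 𝕜 n G v N ∧ ActsTriviallyOn 𝕜 n (isotropy 𝕜 n G v) N

/-- `v` lies on an almost principal orbit. -/
def IsAlmostPrincipalPt (G : Set (Matrix (Fin n) (Fin n) 𝕜)) (v : Fin n → 𝕜) : Prop :=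
  HasClosedOrbit 𝕜 n G v ∧
    ∃ N, IsSliceComplement 𝕜 n G v N ∧ HasFiniteImageOn 𝕜 n (isotropy 𝕜 n G v) N

/-- The set of principal points `V_pr`. -/
def prPoints (G : Set (Matrix (Fin n) (Fin n) 𝕜)) : Set (Fin n → 𝕜) :=
  {v | IsPrincipalPt 𝕜 n G v}

/-- The set of almost principal points `V_apr`. -/
def aprPoints (G : Set (Matrix (Fin n) (Fin n) 𝕜)) : Set (Fin n → 𝕜) :=
  {v | IsAlmostPrincipalPt 𝕜 n G v}

/-- `π⁻¹(π(Y))`: all points that the invariants cannot separate from `Y`. -/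
def saturation (G : Set (Matrix (Fin n) (Fin n) 𝕜)) (Y : Set (Fin n → 𝕜)) :
    Set (Fin n → 𝕜) :=
  {v | ∃ y ∈ Y, ∀ p, Invariant 𝕜 n G p → eval v p = eval y p}

/-- `Y` is `G`-saturated: `Y = π⁻¹(π(Y))`. -/
def IsSaturated (G : Set (Matrix (Fin n) (Fin n) 𝕜)) (Y : Set (Fin n → 𝕜)) : Prop :=
  Y = saturation 𝕜 n G Y

/-- The fiber `π⁻¹(π(v))` of the quotient morphism. -/
def piFiber (G : Set (Matrix (Fin n) (Fin n) 𝕜)) (v : Fin n → 𝕜) : Set (Fin n → 𝕜) :=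
  {u | ∀ p, Invariant 𝕜 n G p → eval u p = eval v p}

/-- The invariant ring `𝕜[V]^G` as a subalgebra of `𝕜[V]`. -/
def invariantSubalgebra (G : Set (Matrix (Fin n) (Fin n) 𝕜)) :
    Subalgebra 𝕜 (MvPolynomial (Fin n) 𝕜) where
  carrier := {p | Invariant 𝕜 n G p}
  mul_mem' := by intro a b ha hb g hg v; simp [ha g hg v, hb g hg v]
  one_mem' := by intro g hg v; simp
  add_mem' := by intro a b ha hb g hg v; simp [ha g hg v, hb g hg v]
  zero_mem' := by intro g hg v; simp
  algebraMap_mem' := by intro r g hg v; simp [MvPolynomial.algebraMap_eq]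

/-- The representation is cofree: `𝕜[V]` is a free module over `𝕜[V]^G`. -/
def IsCofree (G : Set (Matrix (Fin n) (Fin n) 𝕜)) : Prop :=
  Module.Free ↥(invariantSubalgebra 𝕜 n G) (MvPolynomial (Fin n) 𝕜)

/-- The vanishing ideal of `π(Y)` in `𝕜[V//G] = 𝕜[V]^G`. -/
def quotVanishingIdeal (G : Set (Matrix (Fin n) (Fin n) 𝕜)) (Y : Set (Fin n → 𝕜)) :
    Ideal ↥(invariantSubalgebra 𝕜 n G) where
  carrier := {p | ∀ y ∈ Y, eval y (p : MvPolynomial (Fin n) 𝕜) = 0}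
  zero_mem' := by intro y hy; simp
  add_mem' := by intro a b ha hb y hy; simp [ha y hy, hb y hy]
  smul_mem' := by intro c p hp y hy; simp [smul_eq_mul, hp y hy]

/-- The module is stable: there is a nonempty Zariski-open set of points with closed orbit. -/
def IsStableModule (G : Set (Matrix (Fin n) (Fin n) 𝕜)) : Prop :=
  ∃ U : Set (Fin n → 𝕜), U.Nonempty ∧ IsAlgebraicSet 𝕜 n Uᶜ ∧
    ∀ v ∈ U, HasClosedOrbit 𝕜 n G v

/-- `G` is Zariski closed in `GL_n(𝕜)`. -/
def IsZClosedInGL (G : Set (Matrix (Fin n) (Fin n) 𝕜)) : Prop :=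
  ∃ P : Set (MvPolynomial (Fin n × Fin n) 𝕜),
    G = {g | IsUnit g ∧ ∀ p ∈ P, eval (fun ij => g ij.1 ij.2) p = 0}

/-- `G` is a (linearly) reductive algebraic group: a Zariski closed subgroup of `GL_n`
containing a Zariski-dense compact subgroup (the unitarian trick characterization). -/
def IsReductiveGroup (G : Set (Matrix (Fin n) (Fin n) 𝕜)) : Prop :=
  IsMatSubgroup 𝕜 n G ∧ IsZClosedInGL 𝕜 n G ∧
    ∃ K : Set (Matrix (Fin n) (Fin n) 𝕜), K ⊆ G ∧ IsCompact K ∧ IsMatSubgroup 𝕜 n K ∧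
      ∀ p : MvPolynomial (Fin n × Fin n) 𝕜,
        (∀ k ∈ K, eval (fun ij => k ij.1 ij.2) p = 0) →
          ∀ g ∈ G, eval (fun ij => g ij.1 ij.2) p = 0

/-- The isotropy groups of `v` and `w` are conjugate in `G`. -/
def ConjIsotropy (G : Set (Matrix (Fin n) (Fin n) 𝕜)) (v w : Fin n → 𝕜) : Prop :=
  ∃ g ∈ G, isotropy 𝕜 n G w = (fun h => g * h * g⁻¹) '' isotropy 𝕜 n G v

/-- The (Luna) stratum of `V` determined by a point `v` with closed orbit: the inverse image
under `π` of the set of closed orbits with isotropy group conjugate to `G_v`. -/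
def stratumOf (G : Set (Matrix (Fin n) (Fin n) 𝕜)) (v : Fin n → 𝕜) : Set (Fin n → 𝕜) :=
  {u | ∃ w, HasClosedOrbit 𝕜 n G w ∧ w ∈ zclosure 𝕜 n (orbit 𝕜 n G u) ∧
    ConjIsotropy 𝕜 n G v w}

/-- Dimension of (the Zariski closure of) a subset of `𝕜ⁿ`, as the Krull dimension of its
coordinate ring. -/
def adim (X : Set (Fin n → 𝕜)) : WithBot ℕ∞ :=
  ringKrullDim (MvPolynomial (Fin n) 𝕜 ⧸ vanishingIdeal 𝕜 n X)

/-- A nonempty algebraic set with prime vanishing ideal, i.e. an irreducible algebraic set. -/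
def IsIrredAlg (Z : Set (Fin n → 𝕜)) : Prop :=
  IsAlgebraicSet 𝕜 n Z ∧ Z.Nonempty ∧ (vanishingIdeal 𝕜 n Z).IsPrime

/-- `Z` is an irreducible component of `Y`. -/
def IsIrredComponentOf (Y Z : Set (Fin n → 𝕜)) : Prop :=
  IsIrredAlg 𝕜 n Z ∧ Z ⊆ Y ∧
    ∀ Z', IsIrredAlg 𝕜 n Z' → Z ⊆ Z' → Z' ⊆ Y → Z' = Z

/-- The rank at `v` of the differential of `f = (f_1, …, f_d) : V → 𝕜^d`. -/
def jacRank {d : ℕ} (f : Fin d → MvPolynomial (Fin n) 𝕜) (v : Fin n → 𝕜) : ℕ :=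
  (Matrix.of fun (i : Fin d) (j : Fin n) => eval v (pderiv j (f i))).rank

/-- A polynomial is `H`-invariant as a function on the submodule `N`. -/
def InvariantOn (H : Set (Matrix (Fin n) (Fin n) 𝕜)) (N : Submodule 𝕜 (Fin n → 𝕜))
    (p : MvPolynomial (Fin n) 𝕜) : Prop :=
  ∀ g ∈ H, ∀ x ∈ N, eval (Matrix.mulVec g x) p = eval x p

/-- The null cone of the `H`-module `N`: points of `N` which the `H`-invariant functions on `N`
cannot separate from `0`. -/
def sliceNullCone (H : Set (Matrix (Fin n) (Fin n) 𝕜)) (N : Submodule 𝕜 (Fin n → 𝕜)) :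
    Set (Fin n → 𝕜) :=
  {x | x ∈ N ∧ ∀ p, InvariantOn 𝕜 n H N p → eval x p = eval (0 : Fin n → 𝕜) p}

/-- The `H`-module `N` is coreduced: the vanishing ideal of its null cone in `𝕜[N]` is
generated by `H`-invariant functions.  (Stated in `𝕜[V]`: the vanishing ideal of the null
cone equals the ideal generated by the invariant functions vanishing on it together with the
vanishing ideal of `N`.) -/
def CoreducedOn (H : Set (Matrix (Fin n) (Fin n) 𝕜)) (N : Submodule 𝕜 (Fin n → 𝕜)) : Prop :=
  vanishingIdeal 𝕜 n (sliceNullCone 𝕜 n H N) =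
    Ideal.span ({p | InvariantOn 𝕜 n H N p ∧ ∀ x ∈ sliceNullCone 𝕜 n H N, eval x p = 0} ∪
      {p | ∀ x ∈ (N : Set (Fin n → 𝕜)), eval x p = 0})

/-- Complexification of a real vector. -/
def cVec (w : Fin n → ℝ) : Fin n → ℂ := fun i => (w i : ℂ)

/-- The complexification `G = K_ℂ` of a compact matrix group `K ⊆ GL_n(ℝ)`: the Zariski
closure of `K` in the complex matrices. -/
def complexifiedGroup (K : Set (Matrix (Fin n) (Fin n) ℝ)) :
    Set (Matrix (Fin n) (Fin n) ℂ) :=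
  {g | ∀ p : MvPolynomial (Fin n × Fin n) ℂ,
    (∀ k ∈ K, eval (fun ij => (k ij.1 ij.2 : ℂ)) p = 0) →
      eval (fun ij => g ij.1 ij.2) p = 0}

/-- The complexification `Y = X_ℂ ⊆ ℂⁿ` of `X ⊆ ℝⁿ`: the Zariski closure of `X` in `ℂⁿ`. -/
def complexification (X : Set (Fin n → ℝ)) : Set (Fin n → ℂ) :=
  zclosure ℂ n (cVec n '' X)

open Filter Topology

section BanachAlgebra

variable {𝔸 : Type*} [NormedRing 𝔸]

lemma norm_pow_sub_pow_le {a b : 𝔸} {C D : ℝ} (hC : 0 ≤ C)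
    (ha : ∀ i, ‖a ^ i‖ ≤ C) (m : ℕ) (hb : ∀ i ≤ m, ‖b ^ i‖ ≤ D) :
    ‖a ^ m - b ^ m‖ ≤ m * (C * ‖a - b‖ * D) := by
  induction m with
  | zero => simp
  | succ m _ =>
    have key : ∀ j ≤ m + 1, a ^ (m + 1) - b ^ (m + 1) =
        a ^ j * (a ^ (m + 1 - j) - b ^ (m + 1 - j)) +
          ∑ i ∈ Finset.range j, a ^ i * (a - b) * b ^ (m - i) := by
      intro j hj
      induction j with
      | zero => simp
      | succ j ihj =>
        rw [ihj (by omega), Finset.sum_range_succ]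
        have : m + 1 - j = (m - j) + 1 := by omega
        rw [this, show m + 1 - (j + 1) = m - j by omega, pow_succ' a (m - j),
          pow_succ' b (m - j), pow_succ a j]
        noncomm_ring
    rw [key (m + 1) le_rfl]
    simp only [Nat.sub_self, pow_zero, sub_self, mul_zero, zero_add]
    refine (norm_sum_le _ _).trans ?_
    calc ∑ i ∈ Finset.range (m + 1), ‖a ^ i * (a - b) * b ^ (m - i)‖
        ≤ ∑ i ∈ Finset.range (m + 1), C * ‖a - b‖ * D := by
          refine Finset.sum_le_sum fun i _ => ?_
          refine (norm_mul_le _ _).trans (mul_le_mul ((norm_mul_le _ _).trans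
            (mul_le_mul_of_nonneg_right (ha i) (norm_nonneg _))) (hb _ (by omega))
            (norm_nonneg _) (by positivity))
      _ = _ := by simp

variable [NormedAlgebra ℝ 𝔸] [CompleteSpace 𝔸]

lemma tendsto_smul_exp_sub_one (A : 𝔸) {s : ℕ → ℝ} (hs : Tendsto s atTop (𝓝 0))
    (hs0 : ∀ j, 0 < s j) :
    Tendsto (fun j => (s j)⁻¹ • (NormedSpace.exp (s j • A) - 1)) atTop (𝓝 A) := by
  have h := (hasDerivAt_exp_smul_const (𝕂 := ℝ) A (0 : ℝ)).tendsto_slope_zero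
  simp only [zero_smul, NormedSpace.exp_zero, one_mul, zero_add] at h
  exact h.comp (tendsto_nhdsWithin_iff.2 ⟨hs, Eventually.of_forall fun j => (hs0 j).ne'⟩)

/-- Limits of rescaled differences `k - 1` generate one-parameter semigroups in a closed bounded
submonoid. -/
lemma exp_mem_of_tendsto {K : Set 𝔸} (hKc : IsCompact K) (h1 : (1 : 𝔸) ∈ K)
    (hmul : ∀ a ∈ K, ∀ b ∈ K, a * b ∈ K) {k : ℕ → 𝔸} (hk : ∀ j, k j ∈ K) {s : ℕ → ℝ}
    (hs : Tendsto s atTop (𝓝 0)) (hs0 : ∀ j, 0 < s j) {A : 𝔸}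
    (hA : Tendsto (fun j => (s j)⁻¹ • (k j - 1)) atTop (𝓝 A)) {t : ℝ} (ht : 0 ≤ t) :
    NormedSpace.exp (t • A) ∈ K := by
  obtain ⟨C, hC⟩ := hKc.isBounded.exists_norm_le
  have hC0 : 0 ≤ C := (norm_nonneg _).trans (hC _ h1)
  have hpow : ∀ j i, k j ^ i ∈ K := by
    intro j i
    induction i with
    | zero => simpa using h1
    | succ i ih => rw [pow_succ]; exact hmul _ ih _ (hk j)
  have hcont : Continuous fun x : ℝ => NormedSpace.exp (x • A) :=
    continuous_iff_continuousAt.2 fun x =>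
      (hasDerivAt_exp_smul_const (𝕂 := ℝ) A x).continuousAt
  obtain ⟨D, hD⟩ := ((isCompact_Icc (a := (0 : ℝ)) (b := t)).image hcont).isBounded.exists_norm_le
  set m : ℕ → ℕ := fun j => ⌊t / s j⌋₊ with hm
  have hms : ∀ j, m j * s j ≤ t := fun j => by
    rw [← le_div_iff₀ (hs0 j)]; exact Nat.floor_le (div_nonneg ht (hs0 j).le)
  have hms' : ∀ j, t - s j ≤ m j * s j := fun j => by
    have := (Nat.lt_floor_add_one (t / s j)).le
    rw [div_le_iff₀ (hs0 j)] at this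
    simp only [hm]; linarith
  have hmlim : Tendsto (fun j => (m j : ℝ) * s j) atTop (𝓝 t) :=
    tendsto_of_tendsto_of_tendsto_of_le_of_le
      (by simpa using tendsto_const_nhds.sub hs) tendsto_const_nhds hms' hms
  have hexppow : ∀ j (i : ℕ), NormedSpace.exp (s j • A) ^ i =
      NormedSpace.exp (((i : ℝ) * s j) • A) := by
    intro j i
    let : NormedAlgebra ℚ 𝔸 := NormedAlgebra.restrictScalars ℚ ℝ 𝔸
    rw [← NormedSpace.exp_nsmul, mul_smul, Nat.cast_smul_eq_nsmul]
  have hdiff : Tendsto (fun j => (s j)⁻¹ • (k j - NormedSpace.exp (s j • A))) atTop (𝓝 0) := by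
    have := hA.sub (tendsto_smul_exp_sub_one A hs hs0)
    rw [sub_self] at this
    refine this.congr fun j => ?_
    rw [← smul_sub]; congr 1; abel
  have hest : ∀ j, ‖k j ^ m j - NormedSpace.exp (((m j : ℝ) * s j) • A)‖ ≤
      t * (C * ‖(s j)⁻¹ • (k j - NormedSpace.exp (s j • A))‖ * D) := by
    intro j
    rw [← hexppow]
    have hDb : ∀ i ≤ m j, ‖NormedSpace.exp (s j • A) ^ i‖ ≤ D := by
      intro i hi
      rw [hexppow]
      refine hD _ ⟨_, ⟨mul_nonneg (Nat.cast_nonneg _) (hs0 j).le, ?_⟩, rfl⟩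
      exact (mul_le_mul_of_nonneg_right (Nat.cast_le.2 hi) (hs0 j).le).trans (hms j)
    have hD0 : 0 ≤ D := (norm_nonneg _).trans (hDb 0 (Nat.zero_le _))
    refine (norm_pow_sub_pow_le hC0 (fun i => hC _ (hpow j i)) (m j) hDb).trans ?_
    rw [norm_smul, norm_inv, Real.norm_of_nonneg (hs0 j).le]
    have e : (m j : ℝ) * (C * ‖k j - NormedSpace.exp (s j • A)‖ * D) =
        (m j * s j) * (C * ((s j)⁻¹ * ‖k j - NormedSpace.exp (s j • A)‖) * D) := by
      have := (hs0 j).ne'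
      field_simp
    rw [e]
    exact mul_le_mul_of_nonneg_right (hms j)
      (by have := (hs0 j).le; positivity)
  have hlim0 : Tendsto (fun j => k j ^ m j - NormedSpace.exp (((m j : ℝ) * s j) • A))
      atTop (𝓝 0) := by
    refine squeeze_zero_norm hest ?_
    simpa using ((hdiff.norm.const_mul C).mul_const D).const_mul t
  have hlim : Tendsto (fun j => k j ^ m j) atTop (𝓝 (NormedSpace.exp (t • A))) := by
    have := hlim0.add ((hcont.tendsto t).comp hmlim)
    simpa [Function.comp_def] using this
  exact hKc.isClosed.mem_of_tendsto hlim (Eventually.of_forall fun j => hpow j _)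

/-- If a sequence in a compact group `K` avoids a closed subgroup `H` but converges to a point of
`H`, then after translation by elements of `H` it converges to `1` in the direction of a
one-parameter subgroup of `K` that is not contained in `H`. -/
lemma exists_tangent_direction [ProperSpace 𝔸] {K H : Set 𝔸} (hKc : IsCompact K)
    (h1 : (1 : 𝔸) ∈ K) (hmul : ∀ a ∈ K, ∀ b ∈ K, a * b ∈ K) (hinv : ∀ a ∈ K, ∃ b ∈ K, a * b = 1)
    (hHK : H ⊆ K) (hHc : IsClosed H) (hHmul : ∀ a ∈ H, ∀ b ∈ H, a * b ∈ H)
    (hHinv : ∀ a ∈ H, ∃ b ∈ H, a * b = 1 ∧ b * a = 1)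
    {g : ℕ → 𝔸} (hgK : ∀ j, g j ∈ K) (hgH : ∀ j, g j ∉ H) {g₀ : 𝔸} (hg₀ : g₀ ∈ H)
    (hg : Tendsto g atTop (𝓝 g₀)) :
    ∃ (φ : ℕ → ℕ) (h : ℕ → 𝔸) (s : ℕ → ℝ) (A : 𝔸), StrictMono φ ∧ (∀ j, h j ∈ H) ∧
      (∀ j, 0 < s j) ∧ Tendsto s atTop (𝓝 0) ∧
      Tendsto (fun j => (s j)⁻¹ • (g (φ j) * h j - 1)) atTop (𝓝 A) ∧
      (∀ t : ℝ, NormedSpace.exp (t • A) ∈ K) ∧ ¬ ∀ t : ℝ, NormedSpace.exp (t • A) ∈ H := by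
  have hHcpt : IsCompact H := hKc.of_isClosed_subset hHc hHK
  have hmin : ∀ j, ∃ h ∈ H, ∀ h' ∈ H, ‖g j * h - 1‖ ≤ ‖g j * h' - 1‖ := fun j => by
    have := hHcpt.exists_isMinOn ⟨g₀, hg₀⟩
      (f := fun h => ‖g j * h - 1‖) (by fun_prop)
    obtain ⟨h, hh, hm⟩ := this
    exact ⟨h, hh, fun h' hh' => hm hh'⟩
  choose h hhH hhmin using hmin
  have hpos : ∀ j, 0 < ‖g j * h j - 1‖ := fun j => by
    rw [norm_pos_iff, sub_ne_zero]
    intro e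
    obtain ⟨b, hb, hb1, -⟩ := hHinv _ (hhH j)
    apply hgH j
    have : g j = b := by
      calc g j = g j * (h j * b) := by rw [hb1, mul_one]
        _ = b := by rw [← mul_assoc, e, one_mul]
    rwa [this]
  obtain ⟨b₀, hb₀, hgb, -⟩ := hHinv _ hg₀
  have hs : Tendsto (fun j => ‖g j * h j - 1‖) atTop (𝓝 0) := by
    refine squeeze_zero (fun j => norm_nonneg _) (fun j => hhmin j b₀ hb₀) ?_
    have := ((hg.mul_const b₀).sub_const 1).norm
    rwa [hgb, sub_self, norm_zero] at this
  have hsph : ∀ j, (‖g j * h j - 1‖)⁻¹ • (g j * h j - 1) ∈ Metric.sphere (0 : 𝔸) 1 := fun j => by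
    rw [mem_sphere_zero_iff_norm, norm_smul, norm_inv, norm_norm,
      inv_mul_cancel₀ (hpos j).ne']
  obtain ⟨A, -, φ, hφ, hA⟩ := (isCompact_sphere (0 : 𝔸) 1).tendsto_subseq hsph
  have hs' := hs.comp hφ.tendsto_atTop
  have hKpos : ∀ t : ℝ, 0 ≤ t → NormedSpace.exp (t • A) ∈ K := fun t ht =>
    exp_mem_of_tendsto hKc h1 hmul (k := fun j => g (φ j) * h (φ j))
      (fun j => hmul _ (hgK _) _ (hHK (hhH _))) hs' (fun j => hpos _) hA ht
  have hexpinv : ∀ t : ℝ, NormedSpace.exp (t • A) * NormedSpace.exp ((-t) • A) = 1 := fun t => by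
    let : NormedAlgebra ℚ 𝔸 := NormedAlgebra.restrictScalars ℚ ℝ 𝔸
    rw [neg_smul, ← NormedSpace.exp_add_of_commute (Commute.refl _).neg_right, add_neg_cancel,
      NormedSpace.exp_zero]
  refine ⟨φ, fun j => h (φ j), fun j => ‖g (φ j) * h (φ j) - 1‖, A, hφ, fun j => hhH _,
    fun j => hpos _, hs', hA, fun t => ?_, fun hH => ?_⟩
  · rcases le_total 0 t with ht | ht
    · exact hKpos t ht
    · obtain ⟨b, hb, hb1⟩ := hinv _ (hKpos (-t) (by linarith))
      have h2 := hexpinv t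
      have : NormedSpace.exp (t • A) = b := by
        calc NormedSpace.exp (t • A)
            = NormedSpace.exp (t • A) * (NormedSpace.exp ((-t) • A) * b) := by rw [hb1, mul_one]
          _ = b := by rw [← mul_assoc, h2, one_mul]
      rwa [this]
  · set s : ℕ → ℝ := fun j => ‖g (φ j) * h (φ j) - 1‖ with hsdef
    have hdiff : Tendsto (fun j => ((s j)⁻¹ • (g (φ j) * h (φ j) - NormedSpace.exp (s j • A))) *
        NormedSpace.exp ((-s j) • A)) atTop (𝓝 0) := by
      have h3 := hA.sub (tendsto_smul_exp_sub_one A hs' (fun j => hpos _))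
      rw [sub_self] at h3
      have hcont : Continuous fun x : ℝ => NormedSpace.exp (x • A) :=
        continuous_iff_continuousAt.2 fun x =>
          (hasDerivAt_exp_smul_const (𝕂 := ℝ) A x).continuousAt
      have h4 := (hcont.tendsto (-0)).comp hs'.neg
      have h5 := h3.mul h4
      rw [zero_mul] at h5
      refine h5.congr fun j => ?_
      simp only [Function.comp_apply, hsdef]
      rw [← smul_sub]; congr 2; abel
    have hge : ∀ j, 1 ≤ ‖((s j)⁻¹ • (g (φ j) * h (φ j) - NormedSpace.exp (s j • A))) *
        NormedSpace.exp ((-s j) • A)‖ := fun j => by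
      rw [smul_mul_assoc, sub_mul, hexpinv, norm_smul, norm_inv,
        Real.norm_of_nonneg (hpos (φ j)).le, inv_mul_eq_div, le_div_iff₀ (hpos _), one_mul,
        mul_assoc]
      exact hhmin (φ j) _ (hHmul _ (hhH _) _ (hH _))
    have := ge_of_tendsto' hdiff.norm hge
    rw [norm_zero] at this
    linarith

end BanachAlgebra

section Calculus

variable {n}

/-- The maximal ideal of polynomials vanishing at `w`. -/
abbrev maxIdealAt (w : Fin n → ℝ) : Ideal (MvPolynomial (Fin n) ℝ) := vanishingIdeal ℝ n {w}

lemma mem_maxIdealAt {w : Fin n → ℝ} {p : MvPolynomial (Fin n) ℝ} :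
    p ∈ maxIdealAt w ↔ eval w p = 0 := by
  change (∀ x ∈ ({w} : Set _), eval x p = 0) ↔ _
  simp

/-- The derivative of polynomials at `x` in direction `u`. -/
def dirDeriv (x u : Fin n → ℝ) : MvPolynomial (Fin n) ℝ →ₗ[ℝ] ℝ where
  toFun p := ∑ i, eval x (pderiv i p) * u i
  map_add' p q := by simp [add_mul, Finset.sum_add_distrib]
  map_smul' c p := by simp [Finset.mul_sum, mul_assoc, smul_eval]

lemma dirDeriv_apply (x u : Fin n → ℝ) (p : MvPolynomial (Fin n) ℝ) :
    dirDeriv x u p = ∑ i, eval x (pderiv i p) * u i := rfl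

lemma dirDeriv_mul (x u : Fin n → ℝ) (p q : MvPolynomial (Fin n) ℝ) :
    dirDeriv x u (p * q) = eval x p * dirDeriv x u q + eval x q * dirDeriv x u p := by
  simp only [dirDeriv_apply, Finset.mul_sum, ← Finset.sum_add_distrib, Derivation.leibniz,
    smul_eq_mul, map_add, map_mul]
  exact Finset.sum_congr rfl fun i _ => by ring

lemma dirDeriv_add_right (x u v : Fin n → ℝ) (p : MvPolynomial (Fin n) ℝ) :
    dirDeriv x (u + v) p = dirDeriv x u p + dirDeriv x v p := by
  simp [dirDeriv_apply, mul_add, Finset.sum_add_distrib]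

lemma dirDeriv_sub_right (x u v : Fin n → ℝ) (p : MvPolynomial (Fin n) ℝ) :
    dirDeriv x (u - v) p = dirDeriv x u p - dirDeriv x v p := by
  simp [dirDeriv_apply, mul_sub, Finset.sum_sub_distrib]

lemma hasDerivAt_aeval_comp {𝔽 : Type*} [NontriviallyNormedField 𝔽] [NormedAlgebra ℝ 𝔽]
    (p : MvPolynomial (Fin n) ℝ) {γ : 𝔽 → Fin n → 𝔽} {γ' : Fin n → 𝔽} {t : 𝔽}
    (h : ∀ i, HasDerivAt (fun s => γ s i) (γ' i) t) :
    HasDerivAt (fun s => aeval (γ s) p) (∑ i, aeval (γ t) (pderiv i p) * γ' i) t := by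
  induction p using MvPolynomial.induction_on with
  | C a => simpa using hasDerivAt_const t (algebraMap ℝ 𝔽 a)
  | add p q hp hq =>
    simp only [map_add, add_mul, Finset.sum_add_distrib]
    exact hp.add hq
  | mul_X p i hp =>
    simp only [map_mul, aeval_X]
    refine (hp.mul (h i)).congr_deriv ?_
    simp only [Derivation.leibniz, smul_eq_mul, map_add, map_mul, aeval_X, pderiv_X, add_mul,
      Finset.sum_add_distrib, Finset.sum_mul]
    rw [add_comm]
    congr 1
    · rw [Finset.sum_eq_single i]
      · simp
      · intro j _ hj; simp [Ne.symm hj]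
      · simp
    · exact Finset.sum_congr rfl fun j _ => by ring

lemma hasDerivAt_eval_comp (p : MvPolynomial (Fin n) ℝ) {γ : ℝ → Fin n → ℝ} {γ' : Fin n → ℝ}
    {t : ℝ} (h : ∀ i, HasDerivAt (fun s => γ s i) (γ' i) t) :
    HasDerivAt (fun s => eval (γ s) p) (dirDeriv (γ t) γ' p) t := by
  simpa only [coe_aeval_eq_eval, dirDeriv_apply] using! hasDerivAt_aeval_comp p h

lemma hasDerivAt_line (w u : Fin n → ℝ) (t : ℝ) (i : Fin n) :
    HasDerivAt (fun s : ℝ => (w + s • u) i) (u i) t := by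
  simpa using ((hasDerivAt_id t).mul_const (u i)).const_add (w i)

/-- The substitution `p ↦ p ∘ k` for a matrix `k`. -/
def pullback (k : Matrix (Fin n) (Fin n) ℝ) :
    MvPolynomial (Fin n) ℝ →ₐ[ℝ] MvPolynomial (Fin n) ℝ :=
  aeval fun i => ∑ j, C (k i j) * X j

@[simp] lemma eval_pullback (k : Matrix (Fin n) (Fin n) ℝ) (v : Fin n → ℝ)
    (p : MvPolynomial (Fin n) ℝ) : eval v (pullback k p) = eval (k.mulVec v) p := by
  induction p using MvPolynomial.induction_on with
  | C a => simp [pullback, algebraMap_eq]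
  | add p q hp hq => simp [hp, hq]
  | mul_X p i hp => rw [map_mul, map_mul, map_mul, hp]; simp [pullback, Matrix.mulVec, dotProduct]

lemma pullback_mul (k l : Matrix (Fin n) (Fin n) ℝ) (p : MvPolynomial (Fin n) ℝ) :
    pullback (k * l) p = pullback l (pullback k p) :=
  funext fun v => by simp [Matrix.mulVec_mulVec]

@[simp] lemma pullback_one (p : MvPolynomial (Fin n) ℝ) : pullback 1 p = p :=
  funext fun v => by simp

lemma dirDeriv_pullback (k : Matrix (Fin n) (Fin n) ℝ) (x u : Fin n → ℝ)
    (p : MvPolynomial (Fin n) ℝ) :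
    dirDeriv x u (pullback k p) = dirDeriv (k.mulVec x) (k.mulVec u) p := by
  have h1 := hasDerivAt_eval_comp (pullback k p) (hasDerivAt_line x u 0)
  have h2 := hasDerivAt_eval_comp p (hasDerivAt_line (k.mulVec x) (k.mulVec u) 0)
  simp only [eval_pullback, Matrix.mulVec_add, Matrix.mulVec_smul] at h1
  simpa using h1.unique h2

lemma exists_tendsto_of_mem_maxIdealAt_pow (w u : Fin n → ℝ) (k : ℕ)
    {b : MvPolynomial (Fin n) ℝ} (hb : b ∈ maxIdealAt w ^ k) :
    ∃ L : ℝ, ∀ x : ℝ → Fin n → ℝ, x 0 = w → (∀ i, HasDerivAt (fun s => x s i) (u i) 0) →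
      Tendsto (fun τ => eval (x τ) b / τ ^ k) (𝓝[>] 0) (𝓝 L) := by
  induction k generalizing b with
  | zero =>
    refine ⟨eval w b, fun x hx h => ?_⟩
    have := (hasDerivAt_eval_comp b h).continuousAt.tendsto
    rw [hx] at this
    simpa using this.mono_left nhdsWithin_le_nhds
  | succ k ih =>
    rw [pow_succ'] at hb
    induction hb using Submodule.mul_induction_on' with
    | mem_mul_mem a ha c hc =>
      obtain ⟨L, hL⟩ := ih hc
      refine ⟨dirDeriv w u a * L, fun x hx h => ?_⟩
      have h1 := (hasDerivAt_eval_comp a h).tendsto_slope_zero_right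
      rw [hx, mem_maxIdealAt.1 ha] at h1
      refine (h1.mul (hL x hx h)).congr fun τ => ?_
      simp only [zero_add, sub_zero, smul_eq_mul, map_mul, pow_succ]
      rw [inv_mul_eq_div, div_mul_div_comm, mul_comm (τ ^ k)]
    | add a _ c _ iha ihc =>
      obtain ⟨L, hL⟩ := iha
      obtain ⟨M, hM⟩ := ihc
      refine ⟨L + M, fun x hx h => ((hL x hx h).add (hM x hx h)).congr fun τ => ?_⟩
      rw [map_add, add_div]

lemma coeff_eq_zero_of_tendsto (q : Polynomial ℝ) (k : ℕ)
    (h : Tendsto (fun τ => q.eval τ / τ ^ k) (𝓝[>] 0) (𝓝 0)) :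
    ∀ d ≤ k, q.coeff d = 0 := by
  intro d hd
  induction d using Nat.strong_induction_on with
  | _ d ih =>
    obtain ⟨r, hr⟩ : Polynomial.X ^ d ∣ q :=
      Polynomial.X_pow_dvd_iff.2 fun e he => ih e he (by omega)
    have h1 : q.coeff d = r.eval 0 := by
      rw [hr, Polynomial.coeff_X_pow_mul', if_pos le_rfl, Nat.sub_self,
        Polynomial.coeff_zero_eq_eval_zero]
    have h2 : Tendsto (fun τ => r.eval τ) (𝓝[>] 0) (𝓝 (r.eval 0)) :=
      (r.continuous.tendsto 0).mono_left nhdsWithin_le_nhds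
    have h3 : Tendsto (fun τ : ℝ => τ ^ (k - d)) (𝓝[>] 0) (𝓝 (0 ^ (k - d))) :=
      ((continuous_pow (k - d)).tendsto 0).mono_left nhdsWithin_le_nhds
    have h4 := h.mul h3
    rw [zero_mul] at h4
    rw [h1]
    refine tendsto_nhds_unique h2 (h4.congr' ?_)
    filter_upwards [self_mem_nhdsWithin] with τ (hτ : 0 < τ)
    rw [hr, Polynomial.eval_mul, Polynomial.eval_pow, Polynomial.eval_X]
    obtain ⟨e, rfl⟩ := Nat.exists_eq_add_of_le hd
    rw [Nat.add_sub_cancel_left, pow_add]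
    field_simp

lemma eval_smul_of_isHomogeneous {p : MvPolynomial (Fin n) ℝ} {e : ℕ} (hp : p.IsHomogeneous e)
    (τ : ℝ) (u : Fin n → ℝ) : eval (τ • u) p = τ ^ e * eval u p := by
  rw [eval_eq, eval_eq, Finset.mul_sum]
  refine Finset.sum_congr rfl fun d hd => ?_
  have : τ ^ e = ∏ i ∈ d.support, τ ^ d i := by
    rw [Finset.prod_pow_eq_pow_sum, ← hp (mem_support_iff.1 hd), Finsupp.weight_apply]
    simp [Finsupp.sum]
  rw [this, mul_left_comm, ← Finset.prod_mul_distrib]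
  simp [mul_pow]

/-- A polynomial vanishing at `w` to order greater than `k` along every line lies in the
`(k + 1)`-st power of the maximal ideal at `w`. -/
lemma mem_maxIdealAt_pow_of_tendsto (w : Fin n → ℝ) (k : ℕ) (c : MvPolynomial (Fin n) ℝ)
    (h : ∀ u, Tendsto (fun τ : ℝ => eval (w + τ • u) c / τ ^ k) (𝓝[>] 0) (𝓝 0)) :
    c ∈ maxIdealAt w ^ (k + 1) := by
  set c' : MvPolynomial (Fin n) ℝ := aeval (fun i => X i + C (w i)) c with hc'
  have hev : ∀ v, eval v c' = eval (w + v) c := fun v => by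
    have : (eval v).comp (aeval (R := ℝ) fun i => X i + C (w i) :
        MvPolynomial (Fin n) ℝ →ₐ[ℝ] _).toRingHom = eval (w + v) := by
      ext i <;> simp [add_comm]
    exact congrArg (fun f => f c) this
  have hback : aeval (fun i => X i - C (w i)) c' = c := by
    refine funext fun v => ?_
    have : (eval v).comp (aeval (R := ℝ) fun i => X i - C (w i) :
        MvPolynomial (Fin n) ℝ →ₐ[ℝ] _).toRingHom = eval (v - w) := by
      ext i <;> simp
    refine (congrArg (fun f => f c') this).trans ?_
    rw [hev]; simp
  have hhom : ∀ d ≤ k, homogeneousComponent d c' = 0 := by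
    intro d hd
    refine funext fun u => ?_
    set q : Polynomial ℝ := ∑ e ∈ Finset.range (c'.totalDegree + 1),
      Polynomial.C (eval u (homogeneousComponent e c')) * Polynomial.X ^ e with hq
    have hqe : ∀ τ, q.eval τ = eval (w + τ • u) c := fun τ => by
      rw [← hev, ← sum_homogeneousComponent c', hq, Polynomial.eval_finsetSum, map_sum]
      refine Finset.sum_congr rfl fun e _ => ?_
      rw [eval_smul_of_isHomogeneous (homogeneousComponent_isHomogeneous e c')]
      simp only [Polynomial.eval_mul, Polynomial.eval_C, Polynomial.eval_pow, Polynomial.eval_X,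
        mul_comm]
    have h0 := coeff_eq_zero_of_tendsto q k ((h u).congr fun τ => by rw [hqe]) d hd
    rw [hq, Polynomial.finsetSum_coeff] at h0
    simp only [Polynomial.coeff_C_mul, Polynomial.coeff_X_pow, mul_ite, mul_one, mul_zero,
      Finset.sum_ite_eq, Finset.mem_range] at h0
    by_cases hd' : d < c'.totalDegree + 1
    · simpa [hd'] using h0
    · rw [homogeneousComponent_eq_zero _ _ (by omega)]
  have hmem : c' ∈ idealOfVars (Fin n) ℝ ^ (k + 1) := by
    rw [mem_pow_idealOfVars_iff']
    intro x hx
    have := congrArg (coeff x) (hhom x.degree (by omega))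
    simpa [coeff_homogeneousComponent] using this
  rw [← hback]
  have hle : (idealOfVars (Fin n) ℝ).map (aeval (R := ℝ) fun i => X i - C (w i) :
      MvPolynomial (Fin n) ℝ →ₐ[ℝ] MvPolynomial (Fin n) ℝ) ≤ maxIdealAt w := by
    rw [idealOfVars, Ideal.map_span, Ideal.span_le]
    rintro _ ⟨_, ⟨i, rfl⟩, rfl⟩
    rw [SetLike.mem_coe, mem_maxIdealAt]
    simp
  have := Ideal.mem_map_of_mem (aeval (R := ℝ) fun i => X i - C (w i) :
      MvPolynomial (Fin n) ℝ →ₐ[ℝ] MvPolynomial (Fin n) ℝ) hmem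
  rw [Ideal.map_pow] at this
  exact Ideal.pow_right_mono hle _ this

lemma mem_maxIdealAt_sq {w : Fin n → ℝ} {c : MvPolynomial (Fin n) ℝ} (h0 : eval w c = 0)
    (h : ∀ u, dirDeriv w u c = 0) : c ∈ maxIdealAt w ^ 2 := by
  refine mem_maxIdealAt_pow_of_tendsto w 1 c fun u => ?_
  have := (hasDerivAt_eval_comp c (hasDerivAt_line w u 0)).tendsto_slope_zero_right
  simp only [zero_smul, add_zero, h, zero_add, h0, sub_zero] at this
  exact this.congr fun τ => by rw [smul_eq_mul, inv_mul_eq_div, pow_one]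

end Calculus

section Averaging

variable {n}

/-- A right-invariant, strictly positive mean on the continuous functions on a set of matrices. -/
structure InvariantMean (K : Set (Matrix (Fin n) (Fin n) ℝ)) where
  /-- The underlying functional. -/
  mean : C(K, ℝ) →ₗ[ℝ] ℝ
  mean_one : mean 1 = 1
  mean_nonneg : ∀ f, 0 ≤ f → 0 ≤ mean f
  mean_pos : ∀ f, 0 ≤ f → f ≠ 0 → 0 < mean f
  mean_mul_right : ∀ (j : K) (f g : C(K, ℝ)),
    (∀ k l : K, (l : Matrix (Fin n) (Fin n) ℝ) = k * j → g k = f l) → mean g = mean f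

theorem exists_invariantMean {K : Set (Matrix (Fin n) (Fin n) ℝ)} (hK : IsMatSubgroup ℝ n K)
    (hKc : IsCompact K) : Nonempty (InvariantMean K) := by
  obtain ⟨h1, hmul, hinv⟩ := hK
  let _ : Group K :=
    { mul a b := ⟨a * b, hmul a a.2 b b.2⟩
      one := ⟨1, h1⟩
      inv a := ⟨(a : Matrix (Fin n) (Fin n) ℝ)⁻¹, (hinv a a.2).2⟩
      mul_assoc a b c := Subtype.ext (mul_assoc _ _ _)
      one_mul a := Subtype.ext (one_mul _)
      mul_one a := Subtype.ext (mul_one _)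
      inv_mul_cancel a := Subtype.ext <|
        Matrix.nonsing_inv_mul _ ((Matrix.isUnit_iff_isUnit_det _).1 (hinv a a.2).1) }
  have : IsTopologicalGroup K :=
    { continuous_mul := Continuous.subtype_mk
        ((continuous_subtype_val.comp continuous_fst).mul
          (continuous_subtype_val.comp continuous_snd)) _
      continuous_inv := by
        refine Continuous.subtype_mk ?_ _
        simp only [Matrix.inv_def, Ring.inverse_eq_inv']
        refine Continuous.smul (Continuous.inv₀ continuous_subtype_val.matrix_det fun a => ?_)
          continuous_subtype_val.matrix_adjugate
        exact ((Matrix.isUnit_iff_isUnit_det _).1 (hinv a a.2).1).ne_zero }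
  have : CompactSpace K := isCompact_iff_compactSpace.1 hKc
  let _ : MeasurableSpace K := borel K
  have : BorelSpace K := ⟨rfl⟩
  let μ : MeasureTheory.Measure K := MeasureTheory.Measure.haarMeasure ⊤
  have hμ1 : μ Set.univ = 1 := by
    have := MeasureTheory.Measure.haarMeasure_self (G := K) (K₀ := ⊤)
    simpa using this
  have : MeasureTheory.IsProbabilityMeasure μ := ⟨hμ1⟩
  have hint : ∀ f : C(K, ℝ), MeasureTheory.Integrable (fun k => f k⁻¹) μ := fun f =>
    (f.continuous.comp continuous_inv).integrable_of_hasCompactSupport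
      (HasCompactSupport.of_compactSpace _)
  refine ⟨⟨{ toFun f := ∫ k, f k⁻¹ ∂μ, map_add' f g := ?_, map_smul' c f := ?_ }, ?_, ?_, ?_, ?_⟩⟩
  · exact MeasureTheory.integral_add (hint f) (hint g)
  · exact MeasureTheory.integral_const_mul c _
  · simp
  · exact fun f hf => MeasureTheory.integral_nonneg fun k => hf _
  · intro f hf hf0
    obtain ⟨k, hk⟩ : ∃ k, f k ≠ 0 := by
      by_contra! h
      exact hf0 (ContinuousMap.ext h)
    refine Continuous.integral_pos_of_hasCompactSupport_nonneg_nonzero (x := k⁻¹)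
      (f.continuous.comp continuous_inv) (HasCompactSupport.of_compactSpace _) (fun k => hf _) ?_
    simpa using hk
  · intro j f g h
    have := MeasureTheory.integral_mul_left_eq_self (μ := μ) (fun k => f k⁻¹) j⁻¹
    refine Eq.trans (MeasureTheory.integral_congr_ae (Eventually.of_forall fun k => ?_)) this
    refine h _ _ ?_
    change _ = ((k⁻¹ * j : K) : Matrix (Fin n) (Fin n) ℝ)
    rw [mul_inv_rev, inv_inv]

namespace InvariantMean

variable {K : Set (Matrix (Fin n) (Fin n) ℝ)} (M : InvariantMean K)

lemma mean_mono {f g : C(K, ℝ)} (h : f ≤ g) : M.mean f ≤ M.mean g := by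
  have := M.mean_nonneg (g - f) (sub_nonneg.2 h)
  rw [map_sub] at this
  linarith

lemma abs_mean_le {f : C(K, ℝ)} {c : ℝ} (h : ∀ k, |f k| ≤ c) : |M.mean f| ≤ c := by
  have hc : M.mean (c • 1) = c := by rw [map_smul, M.mean_one, smul_eq_mul, mul_one]
  rw [abs_le]
  constructor
  · have := M.mean_mono (f := -(c • 1)) (g := f) fun k => by
      simpa using (abs_le.1 (h k)).1
    rwa [map_neg, hc] at this
  · have := M.mean_mono (f := f) (g := c • 1) fun k => by simpa using (abs_le.1 (h k)).2
    rwa [hc] at this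

/-- By the Weierstrass approximation theorem, an identity between means that holds for all
polynomials in continuous functions holds for all continuous functions of these. -/
lemma mean_comp_eq_of_forall_polynomial (hKc : IsCompact K) {f₁ f₂ β₁ β₂ : C(K, ℝ)}
    (h : ∀ q : Polynomial ℝ, M.mean (q.toContinuousMap.comp f₁ * β₁) =
      M.mean (q.toContinuousMap.comp f₂ * β₂)) (b : C(ℝ, ℝ)) :
    M.mean (b.comp f₁ * β₁) = M.mean (b.comp f₂ * β₂) := by
  have : CompactSpace K := isCompact_iff_compactSpace.1 hKc
  have happ : ∀ ε > 0, |M.mean (b.comp f₁ * β₁) - M.mean (b.comp f₂ * β₂)| ≤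
      ε * (‖β₁‖ + ‖β₂‖) := by
    intro ε hε
    obtain ⟨q, hq⟩ := exists_polynomial_near_of_continuousOn (-(‖f₁‖ + ‖f₂‖)) (‖f₁‖ + ‖f₂‖)
      b b.continuous.continuousOn ε hε
    have key : ∀ f β : C(K, ℝ), ‖f‖ ≤ ‖f₁‖ + ‖f₂‖ →
        |M.mean (q.toContinuousMap.comp f * β) - M.mean (b.comp f * β)| ≤ ε * ‖β‖ := by
      intro f β hf
      rw [← map_sub]
      refine M.abs_mean_le fun k => ?_
      have hk : f k ∈ Set.Icc (-(‖f₁‖ + ‖f₂‖)) (‖f₁‖ + ‖f₂‖) :=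
        abs_le.1 ((f.norm_coe_le_norm k).trans hf)
      have : (q.toContinuousMap.comp f * β - b.comp f * β) k = (q.eval (f k) - b (f k)) * β k := by
        simp [sub_mul]
      rw [this, abs_mul]
      exact mul_le_mul (hq _ hk).le (β.norm_coe_le_norm k) (abs_nonneg _) hε.le
    have k1 := key f₁ β₁ (by linarith [norm_nonneg f₂])
    have k2 := key f₂ β₂ (by linarith [norm_nonneg f₁])
    rw [h q] at k1
    rw [abs_le] at *
    constructor <;> linarith
  have : |M.mean (b.comp f₁ * β₁) - M.mean (b.comp f₂ * β₂)| ≤ 0 := by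
    refine le_of_forall_pos_le_add fun ε hε => ?_
    have hpos : 0 < ‖β₁‖ + ‖β₂‖ + 1 := by positivity
    refine (happ (ε / (‖β₁‖ + ‖β₂‖ + 1)) (by positivity)).trans ?_
    rw [zero_add, div_mul_eq_mul_div, div_le_iff₀ hpos]
    nlinarith [norm_nonneg β₁, norm_nonneg β₂]
  exact sub_eq_zero.1 (abs_nonpos_iff.1 this)

end InvariantMean

lemma exists_pullback_expansion (p : MvPolynomial (Fin n) ℝ) :
    ∃ (s : Finset (Fin n →₀ ℕ)) (φ : (Fin n →₀ ℕ) → C(Matrix (Fin n) (Fin n) ℝ, ℝ)),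
      ∀ k, pullback k p = ∑ a ∈ s, φ a k • monomial a 1 := by
  let A := C(Matrix (Fin n) (Fin n) ℝ, ℝ)
  let Φ : MvPolynomial (Fin n) A :=
    aeval (fun i => ∑ j, C (⟨fun k => k i j, continuous_id.matrix_elem i j⟩ : A) * X j) p
  refine ⟨Φ.support, fun a => coeff a Φ, fun k => ?_⟩
  let e : A →+* ℝ := (Pi.evalRingHom _ k).comp ContinuousMap.coeFnRingHom
  have he : ∀ f, e f = f k := fun _ => rfl
  have h : pullback k p = MvPolynomial.map e Φ := by
    have : (pullback k).toRingHom = (MvPolynomial.map e).comp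
        (aeval (R := ℝ) fun i => ∑ j,
          C (⟨fun k => k i j, continuous_id.matrix_elem i j⟩ : A) * X j).toRingHom := by
      ext i a
      · simp [MvPolynomial.algebraMap_apply, he, A]
      · simp only [AlgHom.toRingHom_eq_coe, RingHom.coe_coe, pullback, aeval_X, RingHom.comp_apply,
          map_sum, map_mul, map_C, map_X, he]
        rfl
    exact congrArg (fun f => f p) this
  rw [h]
  conv_lhs => rw [Φ.as_sum, map_sum]
  refine Finset.sum_congr rfl fun a _ => ?_
  rw [map_monomial, smul_monomial, smul_eq_mul, mul_one]
  rfl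

lemma continuous_pullback (l : MvPolynomial (Fin n) ℝ →ₗ[ℝ] ℝ) (p : MvPolynomial (Fin n) ℝ) :
    Continuous fun k => l (pullback k p) := by
  obtain ⟨s, φ, h⟩ := exists_pullback_expansion p
  simp only [h, map_sum, map_smul, smul_eq_mul]
  exact continuous_finsetSum _ fun a _ => (φ a).continuous.mul continuous_const

/-- The function `k ↦ l (p ∘ k)` on `K`. -/
def matrixCoeff (K : Set (Matrix (Fin n) (Fin n) ℝ)) (l : MvPolynomial (Fin n) ℝ →ₗ[ℝ] ℝ)
    (p : MvPolynomial (Fin n) ℝ) : C(K, ℝ) :=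
  ⟨fun k => l (pullback (k : Matrix (Fin n) (Fin n) ℝ) p),
    (continuous_pullback l p).comp continuous_subtype_val⟩

@[simp] lemma matrixCoeff_apply {K : Set (Matrix (Fin n) (Fin n) ℝ)}
    (l : MvPolynomial (Fin n) ℝ →ₗ[ℝ] ℝ) (p : MvPolynomial (Fin n) ℝ) (k : K) :
    matrixCoeff K l p k = l (pullback (k : Matrix (Fin n) (Fin n) ℝ) p) := rfl

/-- Evaluation at a point as a linear functional. -/
def evalₗ (v : Fin n → ℝ) : MvPolynomial (Fin n) ℝ →ₗ[ℝ] ℝ where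
  toFun := eval v
  map_add' := map_add _
  map_smul' c p := smul_eval v p c

@[simp] lemma evalₗ_apply (v : Fin n → ℝ) (p : MvPolynomial (Fin n) ℝ) :
    evalₗ v p = eval v p := rfl

namespace InvariantMean

variable {K : Set (Matrix (Fin n) (Fin n) ℝ)} (M : InvariantMean K)

lemma exists_average (p : MvPolynomial (Fin n) ℝ) :
    ∃ F : MvPolynomial (Fin n) ℝ, ∀ l : MvPolynomial (Fin n) ℝ →ₗ[ℝ] ℝ,
      l F = M.mean (matrixCoeff K l p) := by
  obtain ⟨s, φ, h⟩ := exists_pullback_expansion p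
  refine ⟨∑ a ∈ s, M.mean ((φ a).comp ⟨_, continuous_subtype_val⟩) • monomial a 1, fun l => ?_⟩
  have : matrixCoeff K l p =
      ∑ a ∈ s, l (monomial a 1) • (φ a).comp ⟨_, continuous_subtype_val⟩ := by
    ext k
    simp [h, mul_comm]
  rw [this]
  simp [mul_comm]

/-- The average of a polynomial over `K`. -/
def average (p : MvPolynomial (Fin n) ℝ) : MvPolynomial (Fin n) ℝ := (M.exists_average p).choose

lemma apply_average (l : MvPolynomial (Fin n) ℝ →ₗ[ℝ] ℝ) (p : MvPolynomial (Fin n) ℝ) :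
    l (M.average p) = M.mean (matrixCoeff K l p) := (M.exists_average p).choose_spec l

lemma eval_average (v : Fin n → ℝ) (p : MvPolynomial (Fin n) ℝ) :
    eval v (M.average p) = M.mean (matrixCoeff K (evalₗ v) p) := by
  rw [← M.apply_average, evalₗ_apply]

lemma invariant_average (p : MvPolynomial (Fin n) ℝ) : Invariant ℝ n K (M.average p) := by
  intro j hj v
  rw [eval_average, eval_average]
  refine M.mean_mul_right ⟨j, hj⟩ _ _ fun k l hkl => ?_
  simp [hkl, Matrix.mulVec_mulVec]

lemma average_mem {V : Submodule ℝ (MvPolynomial (Fin n) ℝ)} {p : MvPolynomial (Fin n) ℝ}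
    (h : ∀ k ∈ K, pullback k p ∈ V) : M.average p ∈ V := by
  by_contra hp
  obtain ⟨l, hl, hV⟩ := Submodule.exists_le_ker_of_notMem hp
  refine hl ?_
  rw [M.apply_average]
  have : matrixCoeff K l p = 0 := by
    ext k
    exact hV (h k k.2)
  rw [this, map_zero]

end InvariantMean

/-- The squared distance to `w`. -/
def sqDist (w : Fin n → ℝ) : MvPolynomial (Fin n) ℝ := ∑ i, (X i - C (w i)) ^ 2

lemma eval_sqDist (w v : Fin n → ℝ) : eval v (sqDist w) = ∑ i, (v i - w i) ^ 2 := by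
  simp [sqDist]

lemma eval_sqDist_nonneg (w v : Fin n → ℝ) : 0 ≤ eval v (sqDist w) := by
  rw [eval_sqDist]; positivity

lemma eval_sqDist_eq_zero {w v : Fin n → ℝ} : eval v (sqDist w) = 0 ↔ v = w := by
  rw [eval_sqDist, Finset.sum_eq_zero_iff_of_nonneg fun i _ => by positivity]
  simp [sub_eq_zero, funext_iff]

lemma eval_polynomial_aeval (v : Fin n → ℝ) (p : MvPolynomial (Fin n) ℝ) (q : Polynomial ℝ) :
    eval v (Polynomial.aeval p q) = q.eval (eval v p) := by
  rw [Polynomial.aeval_def, Polynomial.hom_eval₂, Polynomial.eval,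
    show (eval v).comp (algebraMap ℝ (MvPolynomial (Fin n) ℝ)) = RingHom.id ℝ from
      RingHom.ext fun c => by simp [algebraMap_eq]]

/-- The bump function `t ↦ max (δ - t) 0`. -/
def bump (δ : ℝ) : C(ℝ, ℝ) := ⟨fun t => max (δ - t) 0, by fun_prop⟩

@[simp] lemma bump_apply (δ t : ℝ) : bump δ t = max (δ - t) 0 := rfl

lemma InvariantMean.mean_bump_pos {K : Set (Matrix (Fin n) (Fin n) ℝ)} (M : InvariantMean K)
    (h1 : (1 : Matrix (Fin n) (Fin n) ℝ) ∈ K) (w : Fin n → ℝ) {δ : ℝ} (hδ : 0 < δ) :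
    0 < M.mean ((bump δ).comp (matrixCoeff K (evalₗ w) (sqDist w))) := by
  refine M.mean_pos _ (fun k => le_max_right _ _) fun h => ?_
  have := congrArg (fun f => f ⟨1, h1⟩) h
  have h2 : eval w (sqDist w) = 0 := eval_sqDist_eq_zero.2 rfl
  simp [h2] at this
  linarith

section Orbit

variable {K : Set (Matrix (Fin n) (Fin n) ℝ)}

lemma mem_vanishingIdeal_orbit {w : Fin n → ℝ} {p : MvPolynomial (Fin n) ℝ} :
    p ∈ vanishingIdeal ℝ n (orbit ℝ n K w) ↔ ∀ k ∈ K, eval (k.mulVec w) p = 0 := by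
  change (∀ x ∈ orbit ℝ n K w, eval x p = 0) ↔ _
  simp [orbit]

lemma Invariant.pullback_eq {p : MvPolynomial (Fin n) ℝ} (h : Invariant ℝ n K p)
    {k : Matrix (Fin n) (Fin n) ℝ} (hk : k ∈ K) : pullback k p = p :=
  MvPolynomial.funext fun v => by rw [eval_pullback, h k hk]

lemma sub_eval_mem_invariantIdeal {p : MvPolynomial (Fin n) ℝ} (h : Invariant ℝ n K p)
    (w : Fin n → ℝ) : p - C (eval w p) ∈ invariantIdeal ℝ n K (orbit ℝ n K w) := by
  refine Ideal.subset_span ⟨fun g hg v => by simp [h g hg v], ?_⟩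
  rintro _ ⟨g, hg, rfl⟩
  simp [h g hg w]

lemma invariantIdeal_le (w : Fin n → ℝ) : invariantIdeal ℝ n K (orbit ℝ n K w) ≤
    vanishingIdeal ℝ n (orbit ℝ n K w) :=
  Ideal.span_le.2 fun _ hp => hp.2

/-- The invariants separate the orbits of a compact group. -/
theorem mem_orbit_of_forall_eval_eq_zero (hK : IsMatSubgroup ℝ n K) (hKc : IsCompact K)
    {w y : Fin n → ℝ} (h : ∀ p ∈ invariantIdeal ℝ n K (orbit ℝ n K w), eval y p = 0) :
    y ∈ orbit ℝ n K w := by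
  by_contra hy
  obtain ⟨M⟩ := exists_invariantMean hK hKc
  obtain ⟨δ, hδ, hmin⟩ : ∃ δ > 0, ∀ k ∈ K, δ ≤ eval (k.mulVec y) (sqDist w) := by
    have hc : Continuous fun k : Matrix (Fin n) (Fin n) ℝ => eval (k.mulVec y) (sqDist w) := by
      simpa using continuous_pullback (evalₗ y) (sqDist w)
    obtain ⟨k₀, hk₀, hmin⟩ := hKc.exists_isMinOn ⟨1, hK.1⟩ hc.continuousOn
    refine ⟨_, lt_of_le_of_ne (eval_sqDist_nonneg _ _) fun h0 => hy ?_, hmin⟩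
    have := eval_sqDist_eq_zero.1 h0.symm
    refine ⟨k₀⁻¹, (hK.2.2 k₀ hk₀).2, ?_⟩
    simp only [← this, Matrix.mulVec_mulVec]
    rw [Matrix.nonsing_inv_mul _ ((Matrix.isUnit_iff_isUnit_det _).1 (hK.2.2 k₀ hk₀).1),
      Matrix.one_mulVec]
  have hpoly : ∀ q : Polynomial ℝ,
      M.mean (q.toContinuousMap.comp (matrixCoeff K (evalₗ y) (sqDist w)) * 1) =
      M.mean (q.toContinuousMap.comp (matrixCoeff K (evalₗ w) (sqDist w)) * 1) := by
    intro q
    have h2 : ∀ v, M.mean (q.toContinuousMap.comp (matrixCoeff K (evalₗ v) (sqDist w)) * 1) =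
        eval v (M.average (Polynomial.aeval (sqDist w) q)) := by
      intro v
      rw [M.eval_average]
      congr 1
      ext k
      simp [eval_polynomial_aeval]
    rw [h2, h2]
    have := h _ (sub_eval_mem_invariantIdeal
      (M.invariant_average (Polynomial.aeval (sqDist w) q)) w)
    simpa [sub_eq_zero] using this
  have := M.mean_comp_eq_of_forall_polynomial hKc hpoly (bump δ)
  rw [mul_one, mul_one] at this
  have h0 : (bump δ).comp (matrixCoeff K (evalₗ y) (sqDist w)) = 0 := by
    ext k
    simpa using hmin k k.2
  rw [h0, map_zero] at this
  exact (M.mean_bump_pos hK.1 w hδ).ne this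

lemma hasClosedOrbit (hK : IsMatSubgroup ℝ n K) (hKc : IsCompact K) (w : Fin n → ℝ) :
    HasClosedOrbit ℝ n K w := fun _ hy =>
  mem_orbit_of_forall_eval_eq_zero hK hKc fun p hp => hy p (invariantIdeal_le w hp)

end Orbit

end Averaging

section LieAlgebra

variable {n}

section MatrixNorm

attribute [local instance] Matrix.linftyOpNormedRing Matrix.linftyOpNormedAlgebra

lemma mexp_eq_exp (A : Matrix (Fin n) (Fin n) ℝ) : mexp ℝ n A = NormedSpace.exp A := by
  rw [NormedSpace.exp_eq_tsum ℝ]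
  rfl

lemma mexp_zero : mexp ℝ n (0 : Matrix (Fin n) (Fin n) ℝ) = 1 := by
  rw [mexp_eq_exp]
  exact NormedSpace.exp_zero

lemma mexp_conj {k : Matrix (Fin n) (Fin n) ℝ} (hk : IsUnit k) (A : Matrix (Fin n) (Fin n) ℝ) :
    mexp ℝ n (k * A * k⁻¹) = k * mexp ℝ n A * k⁻¹ := by
  rw [mexp_eq_exp, mexp_eq_exp]
  exact Matrix.exp_conj k A hk

lemma hasDerivAt_mexp (A : Matrix (Fin n) (Fin n) ℝ) (t : ℝ) (i j : Fin n) :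
    HasDerivAt (fun s : ℝ => mexp ℝ n (s • A) i j) ((mexp ℝ n (t • A) * A) i j) t := by
  simp only [mexp_eq_exp]
  let L : Matrix (Fin n) (Fin n) ℝ →L[ℝ] ℝ :=
    LinearMap.toContinuousLinearMap (Matrix.entryLinearMap ℝ ℝ i j)
  exact L.hasFDerivAt.comp_hasDerivAt t (hasDerivAt_exp_smul_const (𝕂 := ℝ) A t)

lemma matrix_exp_mem_of_tendsto {K : Set (Matrix (Fin n) (Fin n) ℝ)} (hK : IsMatSubgroup ℝ n K)
    (hKc : IsCompact K) {k : ℕ → Matrix (Fin n) (Fin n) ℝ} (hk : ∀ j, k j ∈ K) {s : ℕ → ℝ}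
    (hs : Tendsto s atTop (𝓝 0)) (hs0 : ∀ j, 0 < s j) {A : Matrix (Fin n) (Fin n) ℝ}
    (h : Tendsto (fun j => (s j)⁻¹ • (k j - 1)) atTop (𝓝 A)) {t : ℝ} (ht : 0 ≤ t) :
    mexp ℝ n (t • A) ∈ K := by
  rw [mexp_eq_exp]
  exact exp_mem_of_tendsto hKc hK.1 hK.2.1 hk hs hs0 h ht

lemma tendsto_smul_mexp_sub_one (A : Matrix (Fin n) (Fin n) ℝ) {s : ℕ → ℝ}
    (hs : Tendsto s atTop (𝓝 0)) (hs0 : ∀ j, 0 < s j) :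
    Tendsto (fun j => (s j)⁻¹ • (mexp ℝ n (s j • A) - 1)) atTop (𝓝 A) := by
  simp only [mexp_eq_exp]
  exact tendsto_smul_exp_sub_one A hs hs0

lemma IsMatSubgroup.exists_inv {K : Set (Matrix (Fin n) (Fin n) ℝ)} (hK : IsMatSubgroup ℝ n K)
    {a : Matrix (Fin n) (Fin n) ℝ} (ha : a ∈ K) : ∃ b ∈ K, a * b = 1 ∧ b * a = 1 :=
  have hu := (Matrix.isUnit_iff_isUnit_det _).1 (hK.2.2 a ha).1
  ⟨a⁻¹, (hK.2.2 a ha).2, Matrix.mul_nonsing_inv _ hu, Matrix.nonsing_inv_mul _ hu⟩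

lemma matrix_exists_tangent_direction {K H : Set (Matrix (Fin n) (Fin n) ℝ)}
    (hK : IsMatSubgroup ℝ n K) (hKc : IsCompact K) (hH : IsMatSubgroup ℝ n H) (hHK : H ⊆ K)
    (hHc : IsClosed H) {g : ℕ → Matrix (Fin n) (Fin n) ℝ} (hgK : ∀ j, g j ∈ K)
    (hgH : ∀ j, g j ∉ H) {g₀ : Matrix (Fin n) (Fin n) ℝ} (hg₀ : g₀ ∈ H)
    (hg : Tendsto g atTop (𝓝 g₀)) :
    ∃ (φ : ℕ → ℕ) (h : ℕ → Matrix (Fin n) (Fin n) ℝ) (s : ℕ → ℝ) (A : Matrix (Fin n) (Fin n) ℝ),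
      StrictMono φ ∧ (∀ j, h j ∈ H) ∧ (∀ j, 0 < s j) ∧ Tendsto s atTop (𝓝 0) ∧
      Tendsto (fun j => (s j)⁻¹ • (g (φ j) * h j - 1)) atTop (𝓝 A) ∧
      A ∈ lieAlgebra ℝ n K ∧ A ∉ lieAlgebra ℝ n H := by
  obtain ⟨φ, h, s, A, h1, h2, h3, h4, h5, h6, h7⟩ := exists_tangent_direction hKc hK.1 hK.2.1
    (fun a ha => (hK.exists_inv ha).imp fun b hb => ⟨hb.1, hb.2.1⟩) hHK hHc hH.2.1
    (fun a ha => hH.exists_inv ha) hgK hgH hg₀ hg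
  refine ⟨φ, h, s, A, h1, h2, h3, h4, h5, fun t => ?_, fun h8 => h7 fun t => ?_⟩
  · rw [mexp_eq_exp]
    exact h6 t
  · have := h8 t
    rwa [mexp_eq_exp] at this

end MatrixNorm

lemma hasDerivAt_mexp_mulVec (A : Matrix (Fin n) (Fin n) ℝ) (x : Fin n → ℝ) (t : ℝ) (i : Fin n) :
    HasDerivAt (fun s : ℝ => (mexp ℝ n (s • A)).mulVec x i)
      ((mexp ℝ n (t • A)).mulVec (A.mulVec x) i) t := by
  rw [Matrix.mulVec_mulVec]
  simp only [Matrix.mulVec, dotProduct]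
  exact HasDerivAt.fun_sum fun j _ => (hasDerivAt_mexp A t i j).mul_const (x j)

lemma hasDerivAt_mexp_mulVec_zero (A : Matrix (Fin n) (Fin n) ℝ) (x : Fin n → ℝ) (i : Fin n) :
    HasDerivAt (fun s : ℝ => (mexp ℝ n (s • A)).mulVec x i) (A.mulVec x i) 0 := by
  simpa [mexp_zero] using hasDerivAt_mexp_mulVec A x 0 i

lemma mexp_smul_mulVec_eq_self {A : Matrix (Fin n) (Fin n) ℝ} {x : Fin n → ℝ}
    (h : A.mulVec x = 0) (t : ℝ) : (mexp ℝ n (t • A)).mulVec x = x := by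
  funext i
  have hd := fun s => hasDerivAt_mexp_mulVec A x s i
  simp only [h, Matrix.mulVec_zero, Pi.zero_apply] at hd
  have := is_const_of_deriv_eq_zero (fun s => (hd s).differentiableAt) (fun s => (hd s).deriv) t 0
  simpa [mexp_zero] using this

lemma isMatSubgroup_isotropy {K : Set (Matrix (Fin n) (Fin n) ℝ)} (hK : IsMatSubgroup ℝ n K)
    (w : Fin n → ℝ) : IsMatSubgroup ℝ n (isotropy ℝ n K w) := by
  refine ⟨⟨hK.1, Matrix.one_mulVec w⟩, fun a ha b hb => ⟨hK.2.1 a ha.1 b hb.1, ?_⟩,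
    fun a ha => ⟨(hK.2.2 a ha.1).1, (hK.2.2 a ha.1).2, ?_⟩⟩
  · rw [← Matrix.mulVec_mulVec, hb.2, ha.2]
  · conv_lhs => rw [← ha.2]
    rw [Matrix.mulVec_mulVec,
      Matrix.nonsing_inv_mul _ ((Matrix.isUnit_iff_isUnit_det _).1 (hK.2.2 a ha.1).1),
      Matrix.one_mulVec]

lemma continuous_mulVec_const (w : Fin n → ℝ) :
    Continuous fun g : Matrix (Fin n) (Fin n) ℝ => g.mulVec w :=
  continuous_id.matrix_mulVec continuous_const

lemma isCompact_isotropy {K : Set (Matrix (Fin n) (Fin n) ℝ)} (hKc : IsCompact K)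
    (w : Fin n → ℝ) : IsCompact (isotropy ℝ n K w) :=
  hKc.inter_right (isClosed_singleton.preimage (continuous_mulVec_const w))

variable {K : Set (Matrix (Fin n) (Fin n) ℝ)}

lemma smul_mem_lieAlgebra {A : Matrix (Fin n) (Fin n) ℝ} (hA : A ∈ lieAlgebra ℝ n K) (c : ℝ) :
    c • A ∈ lieAlgebra ℝ n K := fun t => by
  rw [smul_smul]
  exact hA (t * c)

lemma add_mem_lieAlgebra (hK : IsMatSubgroup ℝ n K) (hKc : IsCompact K)
    {A B : Matrix (Fin n) (Fin n) ℝ} (hA : A ∈ lieAlgebra ℝ n K) (hB : B ∈ lieAlgebra ℝ n K) :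
    A + B ∈ lieAlgebra ℝ n K := by
  have hs : Tendsto (fun j : ℕ => 1 / ((j : ℝ) + 1)) atTop (𝓝 0) :=
    tendsto_one_div_add_atTop_nhds_zero_nat
  have hs0 : ∀ j : ℕ, 0 < 1 / ((j : ℝ) + 1) := fun j => by positivity
  have key : ∀ A ∈ lieAlgebra ℝ n K, ∀ B ∈ lieAlgebra ℝ n K, ∀ t : ℝ, 0 ≤ t →
      mexp ℝ n (t • (A + B)) ∈ K := by
    intro A hA B hB t ht
    refine matrix_exp_mem_of_tendsto hK hKc (fun j => hK.2.1 _ (hA (1 / ((j : ℝ) + 1))) _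
      (hB (1 / ((j : ℝ) + 1)))) hs hs0 ?_ ht
    have hA' := tendsto_smul_mexp_sub_one A hs hs0
    have hB' := tendsto_smul_mexp_sub_one B hs hs0
    have hB1 : Tendsto (fun j : ℕ => mexp ℝ n ((1 / ((j : ℝ) + 1)) • B)) atTop (𝓝 1) := by
      have := (hs.smul hB').add_const 1
      rw [zero_smul, zero_add] at this
      exact this.congr fun j => by rw [smul_inv_smul₀ (hs0 j).ne', sub_add_cancel]
    have := (hA'.mul hB1).add hB'
    rw [mul_one] at this
    refine this.congr fun j => ?_
    rw [smul_mul_assoc, ← smul_add, sub_mul, one_mul, sub_add_sub_cancel]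
  intro t
  rcases le_total 0 t with ht | ht
  · exact key A hA B hB t ht
  · have := key _ (smul_mem_lieAlgebra hA (-1)) _ (smul_mem_lieAlgebra hB (-1)) (-t) (by linarith)
    rwa [show (-t) • ((-1 : ℝ) • A + (-1 : ℝ) • B) = t • (A + B) by module] at this

lemma mem_orbitTangent_iff (hK : IsMatSubgroup ℝ n K) (hKc : IsCompact K) {w u : Fin n → ℝ} :
    u ∈ orbitTangent ℝ n K w ↔ ∃ A ∈ lieAlgebra ℝ n K, A.mulVec w = u := by
  refine ⟨fun h => ?_, fun h => Submodule.subset_span h⟩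
  induction h using Submodule.span_induction with
  | mem x hx => exact hx
  | zero => exact ⟨0, fun t => by rw [smul_zero, mexp_zero]; exact hK.1, Matrix.zero_mulVec w⟩
  | add x y _ _ hx hy =>
    obtain ⟨A, hA, rfl⟩ := hx
    obtain ⟨B, hB, rfl⟩ := hy
    exact ⟨A + B, add_mem_lieAlgebra hK hKc hA hB, Matrix.add_mulVec A B w⟩
  | smul c x _ hx =>
    obtain ⟨A, hA, rfl⟩ := hx
    exact ⟨c • A, smul_mem_lieAlgebra hA c, Matrix.smul_mulVec c A w⟩

lemma mulVec_mem_orbitTangent (hK : IsMatSubgroup ℝ n K) (hKc : IsCompact K) {w u : Fin n → ℝ}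
    (hu : u ∈ orbitTangent ℝ n K w) {k : Matrix (Fin n) (Fin n) ℝ} (hk : k ∈ isotropy ℝ n K w) :
    k.mulVec u ∈ orbitTangent ℝ n K w := by
  rw [mem_orbitTangent_iff hK hKc] at *
  obtain ⟨A, hA, rfl⟩ := hu
  have hu := (hK.2.2 k hk.1).1
  refine ⟨k * A * k⁻¹, fun t => ?_, ?_⟩
  · have : t • (k * A * k⁻¹) = k * (t • A) * k⁻¹ := by simp
    rw [this, mexp_conj hu]
    exact hK.2.1 _ (hK.2.1 _ hk.1 _ (hA t)) _ (hK.2.2 k hk.1).2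
  · have := ((isMatSubgroup_isotropy hK w).2.2 k hk).2.2
    rw [← Matrix.mulVec_mulVec, this, Matrix.mulVec_mulVec]

lemma dirDeriv_eq_zero_of_mem_orbitTangent (hK : IsMatSubgroup ℝ n K) (hKc : IsCompact K)
    {w u : Fin n → ℝ} (hu : u ∈ orbitTangent ℝ n K w) {p : MvPolynomial (Fin n) ℝ}
    (hp : p ∈ vanishingIdeal ℝ n (orbit ℝ n K w)) : dirDeriv w u p = 0 := by
  obtain ⟨A, hA, rfl⟩ := (mem_orbitTangent_iff hK hKc).1 hu
  have h := hasDerivAt_eval_comp p (hasDerivAt_mexp_mulVec_zero A w)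
  rw [mem_vanishingIdeal_orbit] at hp
  simp only [hp _ (hA _), zero_smul, mexp_zero, Matrix.one_mulVec] at h
  exact h.unique (hasDerivAt_const _ _)

/-- The velocity of a curve in the orbit is tangent to the orbit. -/
lemma mem_orbitTangent_of_curve (hK : IsMatSubgroup ℝ n K) (hKc : IsCompact K) {w u : Fin n → ℝ}
    {γ : ℝ → Fin n → ℝ} (h0 : γ 0 = w) (hγ : ∀ i, HasDerivAt (fun s => γ s i) (u i) 0)
    (hmem : ∀ᶠ t in 𝓝[>] 0, γ t ∈ orbit ℝ n K w) : u ∈ orbitTangent ℝ n K w := by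
  rcases eq_or_ne u 0 with rfl | hu
  · exact zero_mem _
  have hslope : ∀ i, Tendsto (fun t : ℝ => t⁻¹ * (γ t i - w i)) (𝓝[>] 0) (𝓝 (u i)) := fun i => by
    have := (hγ i).tendsto_slope_zero_right
    simpa [h0] using this
  obtain ⟨i₀, hi₀⟩ := Function.ne_iff.1 hu
  have hne : ∀ᶠ t in 𝓝[>] (0 : ℝ), γ t ≠ w := by
    filter_upwards [(hslope i₀).eventually_ne hi₀] with t ht htw
    simp [htw] at ht
  obtain ⟨t, ht, htp⟩ := exists_seq_forall_of_frequently (hmem.and hne).frequently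
  choose g hgK hg using fun j => (htp j).1
  have : FirstCountableTopology (Matrix (Fin n) (Fin n) ℝ) :=
    inferInstanceAs (FirstCountableTopology (Fin n → Fin n → ℝ))
  obtain ⟨g₀, hg₀, ψ, hψ, hlim⟩ := hKc.tendsto_subseq hgK
  have htψ := ht.comp hψ.tendsto_atTop
  have hγ0 : Tendsto (fun j => γ (t (ψ j))) atTop (𝓝 w) := by
    rw [tendsto_pi_nhds]
    intro i
    have := ((hγ i).continuousAt.tendsto.mono_left nhdsWithin_le_nhds).comp htψ
    rwa [h0] at this
  have hg₀w : g₀.mulVec w = w := by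
    refine tendsto_nhds_unique (((continuous_mulVec_const w).tendsto g₀).comp hlim) ?_
    exact hγ0.congr fun j => (hg (ψ j)).symm
  obtain ⟨φ, h, s, A, hφ, hh, hs, -, hA, hAK, hAH⟩ :=
    matrix_exists_tangent_direction hK hKc (isMatSubgroup_isotropy hK w) (fun _ hk => hk.1)
      (isCompact_isotropy hKc w).isClosed (fun j => hgK (ψ j))
      (fun j hj => (htp (ψ j)).2 ((hg (ψ j)).symm.trans hj.2)) ⟨hg₀, hg₀w⟩ hlim
  have hAw : A.mulVec w ≠ 0 := fun h =>
    hAH fun t => ⟨hAK t, mexp_smul_mulVec_eq_self h t⟩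
  obtain ⟨k₀, hk₀⟩ := Function.ne_iff.1 hAw
  have hlimA : ∀ i, Tendsto (fun j => (s j)⁻¹ * (γ (t (ψ (φ j))) i - w i)) atTop
      (𝓝 (A.mulVec w i)) := fun i => by
    have := ((continuous_apply i).tendsto _).comp (((continuous_mulVec_const w).tendsto A).comp hA)
    refine this.congr fun j => ?_
    simp only [Function.comp_apply, Matrix.smul_mulVec, Matrix.sub_mulVec, ← Matrix.mulVec_mulVec,
      (hh j).2, Matrix.one_mulVec, Pi.smul_apply, Pi.sub_apply, smul_eq_mul]
    rw [← hg]
  have hlimu : ∀ i, Tendsto (fun j => (t (ψ (φ j)))⁻¹ * (γ (t (ψ (φ j))) i - w i)) atTop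
      (𝓝 (u i)) := fun i => (hslope i).comp (htψ.comp hφ.tendsto_atTop)
  have hcross : ∀ i, u i * A.mulVec w k₀ = u k₀ * A.mulVec w i := fun i => by
    refine tendsto_nhds_unique ((hlimu i).mul (hlimA k₀)) ?_
    exact ((hlimu k₀).mul (hlimA i)).congr fun j => by ring
  rw [mem_orbitTangent_iff hK hKc]
  refine ⟨(u k₀ / A.mulVec w k₀) • A, smul_mem_lieAlgebra hAK _, ?_⟩
  ext i
  rw [Matrix.smul_mulVec, Pi.smul_apply, smul_eq_mul, div_mul_eq_mul_div, ← hcross,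
    mul_div_cancel_right₀ _ hk₀]

end LieAlgebra

section VectorField

variable {n}

lemma contDiff_eval (p : MvPolynomial (Fin n) ℝ) :
    ContDiff ℝ 1 fun x : Fin n → ℝ => eval x p := by
  induction p using MvPolynomial.induction_on with
  | C a => simpa using contDiff_const
  | add p q hp hq => simpa using hp.add hq
  | mul_X p i hp => simpa using hp.mul (contDiff_apply ℝ ℝ i)

/-- If a polynomial vector field preserves an ideal, then its integral curves starting on the zero
set of the ideal stay there. -/
lemma exists_curve_of_derivation_mem {I : Ideal (MvPolynomial (Fin n) ℝ)}
    (ξ : Fin n → MvPolynomial (Fin n) ℝ) (hξ : ∀ g ∈ I, ∑ i, pderiv i g * ξ i ∈ I)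
    {w : Fin n → ℝ} (hw : ∀ g ∈ I, eval w g = 0) :
    ∃ γ : ℝ → Fin n → ℝ, γ 0 = w ∧ (∀ i, HasDerivAt (fun t => γ t i) (eval w (ξ i)) 0) ∧
      ∀ᶠ t in 𝓝[>] 0, ∀ g ∈ I, eval (γ t) g = 0 := by
  have hcd : ContDiff ℝ 1 fun x : Fin n → ℝ => fun i => eval x (ξ i) :=
    contDiff_pi.2 fun i => contDiff_eval (ξ i)
  obtain ⟨γ, h0, ε, hε, hγ⟩ := hcd.contDiffAt (x := w)
    |>.exists_forall_mem_closedBall_exists_eq_forall_mem_Ioo_hasDerivAt₀ 0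
  rw [zero_sub, zero_add] at hγ
  have hγi : ∀ t ∈ Set.Ioo (-ε) ε, ∀ i, HasDerivAt (fun s => γ s i) (eval (γ t) (ξ i)) t :=
    fun t ht i => hasDerivAt_pi.1 (hγ t ht) i
  refine ⟨γ, h0, fun i => by simpa [h0] using hγi 0 ⟨by linarith, hε⟩ i, ?_⟩
  obtain ⟨S, hS⟩ : I.FG := IsNoetherian.noetherian I
  have hcoef : ∀ g : S, ∃ a : S → MvPolynomial (Fin n) ℝ,
      ∑ l, a l • (l : MvPolynomial (Fin n) ℝ) = ∑ i, pderiv i (g : MvPolynomial (Fin n) ℝ) * ξ i :=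
    fun g => Submodule.mem_span_finset'.1 (hS.ge (hξ g (hS.le (Submodule.subset_span g.2))))
  choose a ha using hcoef
  have hsub : Set.Icc 0 (ε / 2) ⊆ Set.Ioo (-ε) ε := fun t ht =>
    ⟨by linarith [ht.1], by linarith [ht.2]⟩
  have hcont : ContinuousOn γ (Set.Icc 0 (ε / 2)) := fun t ht =>
    (hγ t (hsub ht)).continuousAt.continuousWithinAt
  let G : ℝ → S → ℝ := fun t g => eval (γ t) (g : MvPolynomial (Fin n) ℝ)
  let G' : ℝ → S → ℝ := fun t g => ∑ l, eval (γ t) (a g l) * G t l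
  have hG : ∀ t ∈ Set.Icc 0 (ε / 2), HasDerivAt G (G' t) t := fun t ht => by
    refine hasDerivAt_pi.2 fun g => ?_
    refine (hasDerivAt_eval_comp (g : MvPolynomial (Fin n) ℝ) (hγi t (hsub ht))).congr_deriv ?_
    have := congrArg (eval (γ t)) (ha g)
    simp only [map_sum, smul_eq_mul, map_mul] at this
    exact this.symm
  obtain ⟨c, hc⟩ : ∃ c, ∀ t ∈ Set.Icc 0 (ε / 2), ∑ g, ∑ l, |eval (γ t) (a g l)| ≤ c := by
    have : ContinuousOn (fun t => ∑ g, ∑ l, |eval (γ t) (a g l)|) (Set.Icc 0 (ε / 2)) :=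
      continuousOn_finsetSum _ fun g _ => continuousOn_finsetSum _ fun l _ =>
        ((contDiff_eval (a g l)).continuous.comp_continuousOn hcont).abs
    obtain ⟨c, hc⟩ := (isCompact_Icc.image_of_continuousOn this).bddAbove
    exact ⟨c, fun t ht => hc ⟨t, ht, rfl⟩⟩
  have hbound : ∀ t ∈ Set.Ico 0 (ε / 2), ‖G' t‖ ≤ c * ‖G t‖ := fun t ht => by
    have htc := hc t ⟨ht.1, ht.2.le⟩
    have hc0 : 0 ≤ c := le_trans (by positivity) htc
    rw [pi_norm_le_iff_of_nonneg (by positivity)]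
    intro g
    calc ‖G' t g‖ ≤ ∑ l, ‖eval (γ t) (a g l) * G t l‖ := norm_sum_le _ _
      _ ≤ ∑ l, |eval (γ t) (a g l)| * ‖G t‖ := by
        refine Finset.sum_le_sum fun l _ => ?_
        rw [norm_mul]
        exact mul_le_mul_of_nonneg_left (norm_le_pi_norm (G t) l) (norm_nonneg _)
      _ = (∑ l, |eval (γ t) (a g l)|) * ‖G t‖ := by rw [Finset.sum_mul]
      _ ≤ c * ‖G t‖ := by
        refine mul_le_mul_of_nonneg_right (le_trans ?_ htc) (norm_nonneg _)
        exact Finset.single_le_sum (f := fun g => ∑ l, |eval (γ t) (a g l)|)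
          (fun g _ => by positivity) (Finset.mem_univ g)
  have hzero := eq_zero_of_abs_deriv_le_mul_abs_self_of_eq_zero_right (f := G) (f' := G') (K := c)
    (fun t ht => (hG t ht).continuousAt.continuousWithinAt)
    (fun t ht => (hG t ⟨ht.1, ht.2.le⟩).hasDerivWithinAt)
    (funext fun g => by
      simpa [G, h0] using hw g (hS ▸ Submodule.subset_span g.2)) hbound
  filter_upwards [Ioo_mem_nhdsGT (half_pos hε)] with t ht g hg
  have hle : I ≤ vanishingIdeal ℝ n {γ t} := by
    rw [← hS]
    refine Submodule.span_le.2 fun l hl => mem_maxIdealAt.2 ?_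
    exact congrFun (hzero t ⟨ht.1.le, ht.2.le⟩) ⟨l, hl⟩
  exact mem_maxIdealAt.1 (hle hg)

lemma det_mul_transpose_ne_zero_iff {r : ℕ} (H : Matrix (Fin r) (Fin n) ℝ) :
    (H * H.transpose).det ≠ 0 ↔ LinearIndependent ℝ H.row := by
  rw [← Matrix.vecMul_injective_iff, Ne, ← Matrix.exists_vecMul_eq_zero_iff,
    ← Matrix.coe_vecMulLinear, ← LinearMap.ker_eq_bot, LinearMap.ker_eq_bot']
  have := Matrix.vecMul_self_mul_conjTranspose_eq_zero H
  rw [Matrix.conjTranspose_eq_transpose_of_trivial] at this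
  simp only [this, Matrix.vecMulLinear_apply]
  push Not
  exact forall_congr' fun v => not_imp_not

/-- The gradient of polynomials at `x`. -/
def gradient (x : Fin n → ℝ) : MvPolynomial (Fin n) ℝ →ₗ[ℝ] Fin n → ℝ where
  toFun p i := eval x (pderiv i p)
  map_add' p q := by ext; simp
  map_smul' c p := by ext; simp [smul_eval]

lemma dirDeriv_eq_dotProduct (x u : Fin n → ℝ) (p : MvPolynomial (Fin n) ℝ) :
    dirDeriv x u p = gradient x p ⬝ᵥ u := rfl

variable {K : Set (Matrix (Fin n) (Fin n) ℝ)}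

lemma pullback_mem_vanishingIdeal_orbit (hK : IsMatSubgroup ℝ n K) {w : Fin n → ℝ}
    {p : MvPolynomial (Fin n) ℝ} (hp : p ∈ vanishingIdeal ℝ n (orbit ℝ n K w))
    {k : Matrix (Fin n) (Fin n) ℝ} (hk : k ∈ K) :
    pullback k p ∈ vanishingIdeal ℝ n (orbit ℝ n K w) := by
  rw [mem_vanishingIdeal_orbit] at *
  intro l hl
  rw [eval_pullback, Matrix.mulVec_mulVec]
  exact hp _ (hK.2.1 k hk l hl)

/-- The space of gradients at `x` of the polynomials in an ideal. -/
def gradientSpace (I : Ideal (MvPolynomial (Fin n) ℝ)) (x : Fin n → ℝ) :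
    Submodule ℝ (Fin n → ℝ) := (I.restrictScalars ℝ).map (gradient x)

lemma finrank_gradientSpace_le (hK : IsMatSubgroup ℝ n K) (w : Fin n → ℝ)
    {k : Matrix (Fin n) (Fin n) ℝ} (hk : k ∈ K) :
    Module.finrank ℝ (gradientSpace (vanishingIdeal ℝ n (orbit ℝ n K w)) (k.mulVec w)) ≤
      Module.finrank ℝ (gradientSpace (vanishingIdeal ℝ n (orbit ℝ n K w)) w) := by
  set I := vanishingIdeal ℝ n (orbit ℝ n K w)
  obtain ⟨l, -, hkl, -⟩ := hK.exists_inv hk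
  refine le_trans (Submodule.finrank_mono (t := (gradientSpace I w).map l.vecMulLinear) ?_)
    (Submodule.finrank_map_le _ _)
  rintro _ ⟨p, hp, rfl⟩
  refine ⟨_, ⟨pullback k p, pullback_mem_vanishingIdeal_orbit hK hp hk, rfl⟩, ?_⟩
  refine dotProduct_eq _ _ fun u => ?_
  rw [Matrix.vecMulLinear_apply, ← Matrix.dotProduct_mulVec, ← dirDeriv_eq_dotProduct,
    dirDeriv_pullback, Matrix.mulVec_mulVec, hkl, Matrix.one_mulVec, dirDeriv_eq_dotProduct]

/-- The tangent space of an orbit of a compact group is cut out by the differentials of the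
polynomials vanishing on the orbit. -/
theorem mem_orbitTangent_iff_dirDeriv (hK : IsMatSubgroup ℝ n K) (hKc : IsCompact K)
    {w u : Fin n → ℝ} : u ∈ orbitTangent ℝ n K w ↔
      ∀ p ∈ vanishingIdeal ℝ n (orbit ℝ n K w), dirDeriv w u p = 0 := by
  refine ⟨fun hu p hp => dirDeriv_eq_zero_of_mem_orbitTangent hK hKc hu hp, fun hu => ?_⟩
  set I := vanishingIdeal ℝ n (orbit ℝ n K w) with hI
  let b := Module.finBasis ℝ (gradientSpace I w)
  choose h hhI hhb using fun i => (b i).2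
  let H : Matrix (Fin _) (Fin n) (MvPolynomial (Fin n) ℝ) := .of fun i j => pderiv j (h i)
  let U : Fin n → MvPolynomial (Fin n) ℝ := fun i => C (u i)
  let Δ := (H * H.transpose).det
  let ξ : Fin n → MvPolynomial (Fin n) ℝ :=
    Δ • (Δ • U - H.transpose.mulVec ((H * H.transpose).adjugate.mulVec (H.mulVec U)))
  have hHξ : H.mulVec ξ = 0 := by
    simp only [ξ, Matrix.mulVec_smul, Matrix.mulVec_sub, Matrix.mulVec_mulVec]
    rw [← Matrix.mul_assoc, ← Matrix.mul_assoc, Matrix.mul_adjugate, Matrix.smul_mul,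
      Matrix.one_mul, Matrix.smul_mulVec, sub_self, smul_zero]
  let Hx : (Fin n → ℝ) → Matrix (Fin _) (Fin n) ℝ := fun x => H.map (eval x)
  have hrow : ∀ x i, (Hx x).row i = gradient x (h i) := fun x i => rfl
  have hΔ : ∀ x, eval x Δ = (Hx x * (Hx x).transpose).det := fun x => by
    rw [RingHom.map_det, RingHom.mapMatrix_apply, Matrix.map_mul, Matrix.transpose_map]
  have hΔw : eval w Δ ≠ 0 := by
    rw [hΔ, det_mul_transpose_ne_zero_iff]
    have : (Hx w).row = Submodule.subtype _ ∘ b := funext fun i => hhb i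
    rw [this]
    exact b.linearIndependent.map' _ (Submodule.ker_subtype _)
  have hξw : ∀ i, eval w (ξ i) = (eval w Δ * eval w Δ) * u i := fun i => by
    have hHU : ∀ i, eval w (H.mulVec U i) = 0 := fun i => by
      have := hu _ (hhI i)
      rw [dirDeriv_apply] at this
      simpa [Matrix.mulVec, dotProduct, H, U] using this
    simp only [ξ, Pi.smul_apply, Pi.sub_apply, smul_eq_mul, map_mul, map_sub, U, eval_C]
    have : eval w (H.transpose.mulVec ((H * H.transpose).adjugate.mulVec (H.mulVec U)) i) = 0 := by
      rw [Matrix.mulVec_mulVec, Matrix.mulVec, dotProduct]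
      simp [hHU]
    rw [this]
    ring
  have hder : ∀ g ∈ I, ∑ i, pderiv i g * ξ i ∈ I := by
    intro g hg
    rw [hI, mem_vanishingIdeal_orbit]
    intro k hk
    set x := k.mulVec w
    have hval : eval x (∑ i, pderiv i g * ξ i) = gradient x g ⬝ᵥ fun i => eval x (ξ i) := by
      rw [map_sum]
      exact Finset.sum_congr rfl fun i _ => by rw [map_mul]; rfl
    rw [hval]
    by_cases hx : eval x Δ = 0
    · have : (fun i => eval x (ξ i)) = 0 := funext fun i => by simp [ξ, hx]
      rw [this, dotProduct_zero]
    have hli : LinearIndependent ℝ (Hx x).row := by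
      rwa [← det_mul_transpose_ne_zero_iff, ← hΔ]
    have hle : Submodule.span ℝ (Set.range (Hx x).row) ≤ gradientSpace I x :=
      Submodule.span_le.2 <| by rintro _ ⟨i, rfl⟩; exact ⟨h i, hhI i, rfl⟩
    have hspan : Submodule.span ℝ (Set.range (Hx x).row) = gradientSpace I x := by
      refine Submodule.eq_of_le_of_finrank_le hle ?_
      rw [finrank_span_eq_card hli, Fintype.card_fin]
      exact finrank_gradientSpace_le hK w hk
    have hmem : gradient x g ∈ Submodule.span ℝ (Set.range (Hx x).row) :=
      hspan ▸ ⟨g, hg, rfl⟩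
    generalize gradient x g = y at hmem ⊢
    induction hmem using Submodule.span_induction with
    | mem y hy =>
      obtain ⟨i, rfl⟩ := hy
      have := congrArg (eval x) (congrFun hHξ i)
      simpa [Matrix.mulVec, dotProduct, Hx] using this
    | zero => exact zero_dotProduct _
    | add y z _ _ hy hz => rw [add_dotProduct, hy, hz, add_zero]
    | smul c y _ hy => rw [smul_dotProduct, hy, smul_zero]
  obtain ⟨γ, h0, hγ, hmem⟩ := exists_curve_of_derivation_mem ξ hder (w := w) fun g hg => by
    simpa using mem_vanishingIdeal_orbit.1 hg 1 hK.1
  have := mem_orbitTangent_of_curve hK hKc (u := (eval w Δ * eval w Δ) • u) h0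
    (fun i => by simpa [hξw] using hγ i) (hmem.mono fun t ht => hasClosedOrbit hK hKc w ht)
  exact (Submodule.smul_mem_iff _ (mul_ne_zero hΔw hΔw)).1 this

end VectorField

section IdealLemmas

variable {R : Type*} [CommRing R] {A B L : Ideal R}

lemma map_mem_pow {σ : R →+* R} (hσ : ∀ x ∈ A, σ x ∈ A) {k : ℕ} {b : R} (hb : b ∈ A ^ k) :
    σ b ∈ A ^ k := by
  have := Ideal.mem_map_of_mem σ hb
  rw [Ideal.map_pow] at this
  exact Ideal.pow_right_mono (Ideal.map_le_iff_le_comap.2 hσ) k this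

/-- If two endomorphisms of a ring agree on an ideal `A` up to an ideal `B`, then they agree on
the powers `A ^ (k + 1)` up to `A ^ k * B`. -/
lemma sub_mem_pow_mul {σ τ : R →+* R} (hσ : ∀ x ∈ A, σ x ∈ A) (hτ : ∀ x ∈ A, τ x ∈ A)
    (h : ∀ x ∈ A, σ x - τ x ∈ B) (k : ℕ) {b : R} (hb : b ∈ A ^ (k + 1)) :
    σ b - τ b ∈ A ^ k * B := by
  induction k generalizing b with
  | zero => simpa using h b (by simpa using hb)
  | succ k ih =>
    rw [pow_succ] at hb
    induction hb using Submodule.mul_induction_on' with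
    | mem_mul_mem x hx y hy =>
      have h1 : (σ x - τ x) * σ y ∈ A ^ (k + 1) * B := by
        rw [pow_succ, mul_right_comm]
        exact Ideal.mul_mem_mul (ih hx) (hσ y hy)
      have h2 : τ x * (σ y - τ y) ∈ A ^ (k + 1) * B :=
        Ideal.mul_mem_mul (map_mem_pow hτ hx) (h y hy)
      convert add_mem h1 h2 using 1
      rw [map_mul, map_mul]
      ring
    | add x _ y _ hx hy =>
      convert add_mem hx hy using 1
      rw [map_add, map_add]
      ring

lemma mul_mem_of_forall_prod_mem {ι : Type*} (s : Finset ι) (c : R)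
    (h : ∀ a : ι → R, (∀ i, a i ∈ A) → c * ∏ i ∈ s, a i ∈ L) {b : R} (hb : b ∈ A ^ s.card) :
    c * b ∈ L := by
  classical
  induction s using Finset.induction_on generalizing c b with
  | empty => simpa using L.mul_mem_right b (h 0 fun _ => A.zero_mem)
  | insert j s hj ih =>
    rw [Finset.card_insert_of_notMem hj, pow_succ'] at hb
    induction hb using Submodule.mul_induction_on' with
    | mem_mul_mem x hx y hy =>
      rw [← mul_assoc]
      refine ih (c * x) (fun a ha => ?_) hy
      have := h (Function.update a j x) fun i => by
        by_cases hi : i = j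
        · subst hi; simpa using hx
        · simpa [hi] using ha i
      rw [Finset.prod_insert hj, Function.update_self, Finset.prod_update_of_notMem hj,
        ← mul_assoc] at this
      exact this
    | add x _ y _ hx hy => rw [mul_add]; exact add_mem hx hy

/-- Krull's intersection theorem in a quotient of a Noetherian ring. -/
lemma exists_mul_sub_mem [IsNoetherianRing R] {x : R} (h : ∀ k, x ∈ B ⊔ A ^ k) :
    ∃ r ∈ A, r * x - x ∈ B := by
  have hmem : Ideal.Quotient.mk B x ∈ (⨅ k, A ^ k • ⊤ : Submodule R (R ⧸ B)) := by
    refine (Submodule.mem_iInf _).2 fun k => ?_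
    obtain ⟨a, ha, b, hb, hab⟩ := Submodule.mem_sup.1 (h k)
    have : Ideal.Quotient.mk B x = b • (1 : R ⧸ B) := by
      rw [← hab, map_add, Ideal.Quotient.eq_zero_iff_mem.2 ha, zero_add, Algebra.smul_def, mul_one]
      rfl
    rw [this]
    exact Submodule.smul_mem_smul hb Submodule.mem_top
  obtain ⟨r, hr⟩ := (Ideal.mem_iInf_smul_pow_eq_bot_iff A _).1 hmem
  refine ⟨r, r.2, ?_⟩
  rw [← Ideal.Quotient.eq_zero_iff_mem, map_sub, map_mul, sub_eq_zero]
  exact hr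

end IdealLemmas

section ConormalSpace

variable {n} {K : Set (Matrix (Fin n) (Fin n) ℝ)} (hK : IsMatSubgroup ℝ n K) (hKc : IsCompact K)
  {w : Fin n → ℝ}
include hK hKc

lemma mem_sup_sq_of_dirDeriv_eq_zero {q : MvPolynomial (Fin n) ℝ} (h0 : eval w q = 0)
    (h : ∀ u ∈ orbitTangent ℝ n K w, dirDeriv w u q = 0) :
    q ∈ vanishingIdeal ℝ n (orbit ℝ n K w) ⊔ maxIdealAt w ^ 2 := by
  set I := vanishingIdeal ℝ n (orbit ℝ n K w)
  have hgr : gradient w q ∈ gradientSpace I w := by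
    by_contra hq
    obtain ⟨l, hl, hI⟩ := Submodule.exists_le_ker_of_notMem hq
    have hl' : ∀ v, l v = v ⬝ᵥ fun i => l (Pi.single i 1) := fun v => by
      conv_lhs => rw [pi_eq_sum_univ' v, map_sum]
      simp [dotProduct]
    refine hl ?_
    rw [hl', ← dirDeriv_eq_dotProduct]
    refine h _ ((mem_orbitTangent_iff_dirDeriv hK hKc).2 fun p hp => ?_)
    rw [dirDeriv_eq_dotProduct, ← hl']
    exact hI ⟨p, hp, rfl⟩
  obtain ⟨p, hp, hpq⟩ := hgr
  have hpI : p ∈ I := hp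
  rw [← add_sub_cancel p q]
  refine Submodule.add_mem_sup hpI (mem_maxIdealAt_sq ?_ fun u => ?_)
  · have : eval w p = 0 := by simpa using mem_vanishingIdeal_orbit.1 hpI 1 hK.1
    rw [map_sub, h0, this, sub_zero]
  · rw [map_sub, dirDeriv_eq_dotProduct, dirDeriv_eq_dotProduct, hpq, sub_self]

omit hKc in
lemma vanishingIdeal_orbit_le_maxIdealAt :
    vanishingIdeal ℝ n (orbit ℝ n K w) ≤ maxIdealAt w := fun p hp =>
  mem_maxIdealAt.2 (by simpa using mem_vanishingIdeal_orbit.1 hp 1 hK.1)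

lemma inf_pow_le_sup {k : ℕ} :
    vanishingIdeal ℝ n (orbit ℝ n K w) ⊓ maxIdealAt w ^ (k + 2) ≤
      maxIdealAt w * vanishingIdeal ℝ n (orbit ℝ n K w) ⊔ maxIdealAt w ^ (k + 3) := by
  set I := vanishingIdeal ℝ n (orbit ℝ n K w) with hI
  set m := maxIdealAt w with hm
  rintro b ⟨hbI, hbm⟩
  set T := orbitTangent ℝ n K w
  obtain ⟨g, hg⟩ := LinearMap.exists_leftInverse_of_injective T.subtype T.ker_subtype
  let Q : Matrix (Fin n) (Fin n) ℝ := LinearMap.toMatrix' (T.subtype ∘ₗ g)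
  have hQ : ∀ u, Q.mulVec u = g u := fun u => by
    rw [← Matrix.toLin'_apply, Matrix.toLin'_toMatrix']; rfl
  have hQT : ∀ u ∈ T, Q.mulVec u = u := fun u hu => by
    rw [hQ]; exact congrArg Subtype.val (LinearMap.congr_fun hg ⟨u, hu⟩)
  let y : Fin n → MvPolynomial (Fin n) ℝ := fun i => C (w i) + ∑ j, C (Q i j) * (X j - C (w j))
  let φ : MvPolynomial (Fin n) ℝ →ₐ[ℝ] MvPolynomial (Fin n) ℝ := aeval y
  have hy : ∀ v i, eval v (y i) = w i + Q.mulVec (v - w) i := fun v i => by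
    simp [y, Matrix.mulVec, dotProduct]
  have hφ : ∀ v p, eval v (φ p) = eval (w + Q.mulVec (v - w)) p := fun v p => by
    induction p using MvPolynomial.induction_on with
    | C a => simp [φ]
    | add p q hp hq => rw [map_add, map_add, hp, hq, map_add]
    | mul_X p i hp => rw [map_mul, map_mul, hp, map_mul, aeval_X, hy, eval_X, Pi.add_apply]
  have hφm : ∀ p ∈ m, φ p ∈ m := fun p hp => by
    rw [hm, mem_maxIdealAt] at *
    rw [hφ, sub_self, Matrix.mulVec_zero, add_zero, hp]
  have hdiff : ∀ p, p - φ p ∈ I ⊔ m ^ 2 := fun p => by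
    refine mem_sup_sq_of_dirDeriv_eq_zero hK hKc ?_ fun u hu => ?_
    · rw [map_sub, hφ, sub_self, Matrix.mulVec_zero, add_zero, sub_self]
    · have h1 := hasDerivAt_eval_comp (p - φ p) (hasDerivAt_line w u 0)
      have h2 : (fun t : ℝ => eval (w + t • u) (p - φ p)) = fun _ => 0 := funext fun t => by
        rw [map_sub, hφ, add_sub_cancel_left, hQT _ (T.smul_mem t hu), sub_self]
      rw [h2] at h1
      simpa using h1.unique (hasDerivAt_const _ _)
  have hφb : φ b ∈ m ^ (k + 3) := by
    refine mem_maxIdealAt_pow_of_tendsto w (k + 2) _ fun u => ?_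
    obtain ⟨L, hL⟩ := exists_tendsto_of_mem_maxIdealAt_pow w (Q.mulVec u) (k + 2) hbm
    obtain ⟨A, hA, hAw⟩ := (mem_orbitTangent_iff hK hKc).1 (show Q.mulVec u ∈ T from
      hQ u ▸ (g u).2)
    have h1 := hL (fun t => (mexp ℝ n (t • A)).mulVec w) (by simp [mexp_zero]) fun i => by
      rw [← hAw]; exact hasDerivAt_mexp_mulVec_zero A w i
    have h2 : L = 0 := tendsto_nhds_unique h1 <| by
      refine tendsto_const_nhds.congr fun t => ?_
      rw [mem_vanishingIdeal_orbit.1 hbI _ (hA t), zero_div]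
    subst h2
    refine (hL (fun t => w + t • Q.mulVec u) (by simp) fun i => by
      simpa using hasDerivAt_line w (Q.mulVec u) 0 i).congr fun t => ?_
    rw [hφ, add_sub_cancel_left, Matrix.mulVec_smul]
  have hsub : b - φ b ∈ m ^ (k + 1) * (I ⊔ m ^ 2) :=
    sub_mem_pow_mul (σ := RingHom.id _) (τ := φ.toRingHom) (fun _ h => h) hφm
      (fun p _ => hdiff p) (k + 1) hbm
  rw [← sub_add_cancel b (φ b)]
  refine add_mem ?_ (Ideal.mem_sup_right hφb)
  rw [Ideal.mul_sup] at hsub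
  refine sup_le_sup (a := m ^ (k + 1) * I) (c := m ^ (k + 1) * m ^ 2) ?_ ?_ hsub
  · rw [pow_succ', mul_assoc]
    exact Ideal.mul_mono_right Ideal.mul_le_right
  · rw [← pow_add]

/-- A polynomial vanishing on the orbit of `w` and vanishing to second order at `w` lies in the
product of the vanishing ideals of `w` and of the orbit. -/
lemma inf_sq_le :
    vanishingIdeal ℝ n (orbit ℝ n K w) ⊓ maxIdealAt w ^ 2 ≤
      maxIdealAt w * vanishingIdeal ℝ n (orbit ℝ n K w) := by
  set I := vanishingIdeal ℝ n (orbit ℝ n K w) with hI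
  set m := maxIdealAt w with hm
  rintro p ⟨hpI, hpm⟩
  have hk : ∀ k, p ∈ m * I ⊔ m ^ (k + 2) := fun k => by
    induction k with
    | zero => exact Ideal.mem_sup_right hpm
    | succ k ih =>
      obtain ⟨a, ha, b, hb, hab⟩ := Submodule.mem_sup.1 ih
      have hbI : b ∈ I := by
        rw [← add_sub_cancel_left a b, hab]
        exact sub_mem hpI (Ideal.mul_le_right ha)
      rw [← hab]
      exact add_mem (Ideal.mem_sup_left ha) (inf_pow_le_sup hK hKc ⟨hbI, hb⟩)
  obtain ⟨r, hr, hr'⟩ := exists_mul_sub_mem fun k => sup_le_sup_left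
    (Ideal.pow_le_pow_right (I := m) (by omega)) (m * I) (hk k)
  rw [← sub_sub_cancel (r * p) p]
  exact sub_mem (Ideal.mul_mem_mul hr hpI) hr'

lemma pullback_sub_pullback_mem {N : Submodule ℝ (Fin n → ℝ)}
    (hN : orbitTangent ℝ n K w ⊔ N = ⊤) {s s' : Matrix (Fin n) (Fin n) ℝ}
    (hs : s ∈ isotropy ℝ n K w) (hs' : s' ∈ isotropy ℝ n K w)
    (h : ∀ x ∈ N, s.mulVec x = s'.mulVec x) (k : ℕ) {b : MvPolynomial (Fin n) ℝ}
    (hb : b ∈ vanishingIdeal ℝ n (orbit ℝ n K w) ^ (k + 1)) :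
    pullback s b - pullback s' b ∈
      maxIdealAt w * vanishingIdeal ℝ n (orbit ℝ n K w) ^ (k + 1) := by
  set I := vanishingIdeal ℝ n (orbit ℝ n K w) with hI
  have key : ∀ a ∈ I, pullback s a - pullback s' a ∈ maxIdealAt w * I := fun a ha => by
    have hmem : pullback s a - pullback s' a ∈ I :=
      sub_mem (pullback_mem_vanishingIdeal_orbit hK ha hs.1)
        (pullback_mem_vanishingIdeal_orbit hK ha hs'.1)
    refine inf_sq_le hK hKc ⟨hmem, mem_maxIdealAt_sq
      (mem_maxIdealAt.1 (vanishingIdeal_orbit_le_maxIdealAt hK hmem)) fun u => ?_⟩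
    obtain ⟨t, ht, x, hx, rfl⟩ := Submodule.mem_sup.1 (hN ▸ Submodule.mem_top : u ∈ _ ⊔ N)
    rw [dirDeriv_add_right, dirDeriv_eq_zero_of_mem_orbitTangent hK hKc ht hmem, map_sub,
      dirDeriv_pullback, dirDeriv_pullback, hs.2, hs'.2, h x hx, sub_self, add_zero]
  have := sub_mem_pow_mul (σ := (pullback s).toRingHom) (τ := (pullback s').toRingHom)
    (fun a ha => pullback_mem_vanishingIdeal_orbit hK ha hs.1)
    (fun a ha => pullback_mem_vanishingIdeal_orbit hK ha hs'.1) key k hb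
  rwa [mul_left_comm, ← pow_succ] at this

end ConormalSpace

section NearlyInvariant

variable {n} {K : Set (Matrix (Fin n) (Fin n) ℝ)} {w : Fin n → ℝ}

/-- If `J` is a stable ideal and `h ∈ J` is fixed by the isotropy group of `w` modulo `𝔪 * J`,
then `h` is congruent modulo `𝔪 * J` to a linear combination of invariants in `J`. -/
lemma InvariantMean.mem_of_forall_pullback_sub_mem (M : InvariantMean K)
    (h1 : (1 : Matrix (Fin n) (Fin n) ℝ) ∈ K) (hKc : IsCompact K)
    {J : Ideal (MvPolynomial (Fin n) ℝ)} (hJ : ∀ k ∈ K, ∀ p ∈ J, pullback k p ∈ J)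
    {V : Submodule ℝ (MvPolynomial (Fin n) ℝ)} (hV : ∀ p ∈ maxIdealAt w * J, p ∈ V)
    (hinv : ∀ p ∈ J, Invariant ℝ n K p → p ∈ V) {h : MvPolynomial (Fin n) ℝ} (hh : h ∈ J)
    (hs : ∀ s ∈ isotropy ℝ n K w, pullback s h - h ∈ maxIdealAt w * J) : h ∈ V := by
  have : CompactSpace K := isCompact_iff_compactSpace.1 hKc
  by_contra hhV
  obtain ⟨l₀, hl₀, hlV₀⟩ := Submodule.exists_le_ker_of_notMem hhV
  obtain ⟨l, hl, hlV⟩ : ∃ l : MvPolynomial (Fin n) ℝ →ₗ[ℝ] ℝ, l h = 1 ∧ ∀ p ∈ V, l p = 0 :=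
    ⟨(l₀ h)⁻¹ • l₀, by simp [hl₀], fun p hp => by
      simp [LinearMap.mem_ker.1 (hlV₀ hp)]⟩
  set f := matrixCoeff K (evalₗ w) (sqDist w) with hf
  set β := matrixCoeff K l h with hβ
  have hpoly : ∀ q : Polynomial ℝ, M.mean (q.toContinuousMap.comp f * β) = 0 := fun q => by
    set g := Polynomial.aeval (sqDist w) q * h with hg
    have hgJ : ∀ k ∈ K, pullback k g ∈ J := fun k hk => hJ k hk _ (J.mul_mem_left _ hh)
    have hav : M.average g ∈ V := hinv _
      (M.average_mem (V := J.restrictScalars ℝ) hgJ) (M.invariant_average g)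
    rw [← hlV _ hav, M.apply_average]
    congr 1
    ext ⟨k, hk⟩
    have hmem : pullback k g - q.eval (f ⟨k, hk⟩) • pullback k h ∈ maxIdealAt w * J := by
      rw [hg, map_mul, smul_eq_C_mul, ← sub_mul]
      refine Ideal.mul_mem_mul (mem_maxIdealAt.2 ?_) (hJ k hk h hh)
      rw [map_sub, eval_pullback, eval_polynomial_aeval, eval_C, hf, matrixCoeff_apply, evalₗ_apply,
        eval_pullback, sub_self]
    have := hlV _ (hV _ hmem)
    rw [map_sub, map_smul, sub_eq_zero] at this
    simpa [hβ] using this.symm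
  have hbump : ∀ δ, M.mean ((bump δ).comp f * β) = 0 := fun δ => by
    rw [M.mean_comp_eq_of_forall_polynomial hKc (f₁ := f) (f₂ := f) (β₁ := β) (β₂ := 0)
      (fun q => by rw [hpoly, mul_zero, map_zero]) (bump δ), mul_zero, map_zero]
  have hf0 : ∀ k, 0 ≤ f k := fun k => by simpa [hf] using eval_sqDist_nonneg w _
  have hfβ : ∀ k, f k = 0 → β k = 1 := fun ⟨k, hk⟩ hfk => by
    have hkw : k.mulVec w = w := by
      simpa [hf, eval_sqDist_eq_zero] using hfk
    have := hlV _ (hV _ (hs k ⟨hk, hkw⟩))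
    rw [map_sub, hl, sub_eq_zero] at this
    simpa [hβ] using this
  obtain ⟨δ, hδ, hδβ⟩ : ∃ δ > 0, ∀ k, β k ≤ 1 / 2 → δ ≤ f k := by
    have hcl : IsCompact {k | β k ≤ 1 / 2} :=
      (isClosed_le β.continuous continuous_const).isCompact
    rcases Set.eq_empty_or_nonempty {k | β k ≤ 1 / 2} with he | hne
    · exact ⟨1, one_pos, fun k hk => absurd hk (Set.eq_empty_iff_forall_notMem.1 he k)⟩
    · obtain ⟨k₀, hk₀, hmin⟩ := hcl.exists_isMinOn hne f.continuous.continuousOn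
      refine ⟨f k₀, lt_of_le_of_ne (hf0 k₀) fun h0 => ?_, fun k hk => hmin hk⟩
      have : β k₀ ≤ 1 / 2 := hk₀
      rw [hfβ k₀ h0.symm] at this
      norm_num at this
  have hle : (1 / 2 : ℝ) • (bump δ).comp f ≤ (bump δ).comp f * β := fun k => by
    change 1 / 2 * max (δ - f k) 0 ≤ max (δ - f k) 0 * β k
    by_cases hk : β k ≤ 1 / 2
    · rw [max_eq_right (sub_nonpos.2 (hδβ k hk))]; simp
    · rw [mul_comm]
      exact mul_le_mul_of_nonneg_left (not_le.1 hk).le (le_max_right _ _)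
  have h2 := M.mean_mono hle
  rw [hbump, map_smul, smul_eq_mul] at h2
  linarith [M.mean_bump_pos h1 w hδ]

end NearlyInvariant

section FiniteImage

variable {n} {K : Set (Matrix (Fin n) (Fin n) ℝ)} (hK : IsMatSubgroup ℝ n K) (hKc : IsCompact K)
  {w : Fin n → ℝ}
include hK hKc

omit hK hKc in
lemma pullback_mem_invariantIdeal {k : Matrix (Fin n) (Fin n) ℝ} (hk : k ∈ K)
    {p : MvPolynomial (Fin n) ℝ} (hp : p ∈ invariantIdeal ℝ n K (orbit ℝ n K w)) :
    pullback k p ∈ invariantIdeal ℝ n K (orbit ℝ n K w) := by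
  have : invariantIdeal ℝ n K (orbit ℝ n K w) ≤
      (invariantIdeal ℝ n K (orbit ℝ n K w)).comap (pullback k) := by
    refine Ideal.span_le.2 fun q hq => ?_
    rw [SetLike.mem_coe, Ideal.mem_comap, hq.1.pullback_eq hk]
    exact Ideal.subset_span hq
  exact this hp

lemma pow_le_invariantIdeal_of_le_sup {d : ℕ}
    (h : vanishingIdeal ℝ n (orbit ℝ n K w) ^ d ≤ invariantIdeal ℝ n K (orbit ℝ n K w) ⊔
      maxIdealAt w * vanishingIdeal ℝ n (orbit ℝ n K w) ^ d) :
    vanishingIdeal ℝ n (orbit ℝ n K w) ^ d ≤ invariantIdeal ℝ n K (orbit ℝ n K w) := by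
  set I := vanishingIdeal ℝ n (orbit ℝ n K w) with hI
  set J := invariantIdeal ℝ n K (orbit ℝ n K w) with hJ
  obtain ⟨M⟩ := exists_invariantMean hK hKc
  obtain ⟨r, hr, hrI⟩ := Submodule.exists_sub_one_mem_and_smul_le_of_fg_of_le_sup
    (IsNoetherian.noetherian (I ^ d)) le_rfl h
  have hrw : eval w r = 1 := by
    have := mem_maxIdealAt.1 hr
    rwa [map_sub, map_one, sub_eq_zero] at this
  set F := M.average (r ^ 2) with hF
  have hFmem : F ∈ (J.colon (I ^ d : Ideal _)).restrictScalars ℝ := by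
    refine M.average_mem fun k hk => ?_
    obtain ⟨k', hk', -, hkk⟩ := hK.exists_inv hk
    refine Submodule.mem_colon.2 fun b hb => ?_
    have hb' : pullback k' b ∈ I ^ d := map_mem_pow (σ := (pullback k').toRingHom)
      (fun a ha => pullback_mem_vanishingIdeal_orbit hK ha hk') hb
    have := pullback_mem_invariantIdeal hk (J.mul_mem_left r
      (hrI (Submodule.smul_mem_pointwise_smul _ r _ hb')))
    rw [smul_eq_mul, ← mul_assoc, ← sq, map_mul, ← pullback_mul, hkk, pullback_one] at this
    exact this
  have hFw : 0 < eval w F := by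
    rw [hF, M.eval_average]
    refine M.mean_pos _ (fun k => ?_) fun h0 => ?_
    · simpa using sq_nonneg _
    · have := congrArg (fun f => f ⟨1, hK.1⟩) h0
      simp [hrw] at this
  intro b hb
  have h1 : F * b ∈ J := Submodule.mem_colon.1 hFmem b hb
  have h2 : (F - C (eval w F)) * b ∈ J :=
    J.mul_mem_right b (sub_eval_mem_invariantIdeal (M.invariant_average _) w)
  have h3 : C (eval w F) * b ∈ J := by
    convert sub_mem h1 h2 using 1
    ring
  have h4 := J.mul_mem_left (C (eval w F)⁻¹) h3
  rwa [← mul_assoc, ← C_mul, inv_mul_cancel₀ hFw.ne', C_1, one_mul] at h4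

/-- If finitely many elements `s i` of the isotropy group represent its image in `GL(N)`, for a
slice `N`, then a power of the vanishing ideal of the orbit lies in the invariant ideal. -/
theorem vanishingIdeal_pow_le {N : Submodule ℝ (Fin n → ℝ)} (hN : IsSliceComplement ℝ n K w N)
    {ι : Type*} [Fintype ι] {s : ι → Matrix (Fin n) (Fin n) ℝ}
    (hs : ∀ i, s i ∈ isotropy ℝ n K w)
    (hrep : ∀ k ∈ isotropy ℝ n K w, ∃! i, ∀ x ∈ N, k.mulVec x = (s i).mulVec x) :
    vanishingIdeal ℝ n (orbit ℝ n K w) ^ Fintype.card ι ≤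
      invariantIdeal ℝ n K (orbit ℝ n K w) := by
  classical
  refine pow_le_invariantIdeal_of_le_sup hK hKc ?_
  set I := vanishingIdeal ℝ n (orbit ℝ n K w) with hI
  set J := invariantIdeal ℝ n K (orbit ℝ n K w) with hJ
  set m := maxIdealAt w with hm
  obtain ⟨M⟩ := exists_invariantMean hK hKc
  have hiso := isMatSubgroup_isotropy hK w
  have hpI : ∀ k ∈ K, ∀ p ∈ I, pullback k p ∈ I := fun k hk p hp =>
    pullback_mem_vanishingIdeal_orbit hK hp hk
  have hpIp : ∀ d, ∀ k ∈ K, ∀ p ∈ I ^ d, pullback k p ∈ I ^ d := fun d k hk p hp =>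
    map_mem_pow (σ := (pullback k).toRingHom) (hpI k hk) hp
  have hcongr := fun {k k' : Matrix (Fin n) (Fin n) ℝ} (hk : k ∈ isotropy ℝ n K w)
    (hk' : k' ∈ isotropy ℝ n K w) h => pullback_sub_pullback_mem hK hKc hN.1.sup_eq_top hk hk' h
  have htr : ∀ d, ∀ b ∈ I ^ (d + 1), ∑ i, pullback (s i) b ∈ J ⊔ m * I ^ (d + 1) := by
    intro d b hb
    refine M.mem_of_forall_pullback_sub_mem hK.1 hKc (hpIp (d + 1)) (w := w)
      (V := (J ⊔ m * I ^ (d + 1)).restrictScalars ℝ) (fun p hp => Ideal.mem_sup_right hp)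
      (fun p hp hinv => Ideal.mem_sup_left (Ideal.subset_span
        ⟨hinv, fun x hx => Ideal.pow_le_self (Nat.succ_ne_zero d) hp x hx⟩))
      (sum_mem fun i _ => hpIp _ _ (hs i).1 _ hb) fun k hk => ?_
    choose e he heu using fun i => hrep (s i * k) (hiso.2.1 _ (hs i) _ hk)
    have hinj : Function.Injective e := fun i j hij => by
      obtain ⟨k', hk', hkk', -⟩ := hiso.exists_inv hk
      refine (hrep (s i) (hs i)).unique (fun x _ => rfl) fun x hx => ?_
      have h1 := he i _ (hN.2 _ hk' x hx)
      have h2 := he j _ (hN.2 _ hk' x hx)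
      rw [← hij, ← h1] at h2
      simpa [Matrix.mulVec_mulVec, mul_assoc, hkk'] using h2.symm
    rw [map_sum, ← (Finite.injective_iff_bijective.1 hinj).sum_comp fun i => pullback (s i) b,
      ← Finset.sum_sub_distrib]
    refine sum_mem fun i _ => ?_
    rw [← pullback_mul]
    exact hcongr (hiso.2.1 _ (hs i) _ hk) (hs _) (he i) d hb
  obtain ⟨i₀, -, -⟩ := hrep 1 hiso.1
  have hcard : (Fintype.card ι : ℝ) ≠ 0 := by
    have : Nonempty ι := ⟨i₀⟩
    exact_mod_cast Fintype.card_ne_zero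
  intro b hb
  rw [← one_mul b]
  refine mul_mem_of_forall_prod_mem (A := I) Finset.univ 1 (fun a ha => ?_) hb
  rw [one_mul]
  let x : ι → ι → MvPolynomial (Fin n) ℝ := fun j i => pullback (s j) (pullback (s i) (a i))
  have hzero : ∀ j, ∏ i, (x j i - a i) ∈ m * I ^ Fintype.card ι := fun j => by
    obtain ⟨k', hk', -, hkk'⟩ := hiso.exists_inv (hs j)
    obtain ⟨i, hi, -⟩ := hrep k' hk'
    rw [← Finset.mul_prod_erase _ _ (Finset.mem_univ i), ← Finset.card_univ,
      ← Finset.card_erase_add_one (Finset.mem_univ i), pow_succ', ← mul_assoc]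
    refine Ideal.mul_mem_mul ?_ ?_
    · have h1 : ∀ y ∈ N, (s i * s j).mulVec y = (1 : Matrix (Fin n) (Fin n) ℝ).mulVec y :=
        fun y hy => by
          rw [← Matrix.mulVec_mulVec, ← hi _ (hN.2 _ (hs j) y hy), Matrix.mulVec_mulVec, hkk']
      have := hcongr (hiso.2.1 _ (hs i) _ (hs j)) hiso.1 h1 0 (b := a i) (by simpa using ha i)
      rw [zero_add, pow_one, pullback_one, pullback_mul] at this
      exact this
    · rw [← Finset.prod_const]
      exact Ideal.prod_mem_prod fun l _ =>
        sub_mem (hpI _ (hs j).1 _ (hpI _ (hs l).1 _ (ha l))) (ha l)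
  have hsum : ∑ j, ∏ i, (x j i - a i) ∈ J ⊔ m * I ^ Fintype.card ι :=
    Ideal.mem_sup_right (sum_mem fun j _ => hzero j)
  simp only [sub_eq_add_neg, Finset.prod_add] at hsum
  rw [Finset.sum_comm, ← Finset.sum_erase_add _ _ (Finset.empty_mem_powerset _)] at hsum
  have hrest : ∑ S ∈ Finset.univ.powerset.erase ∅,
      ∑ j, (∏ i ∈ S, x j i) * ∏ i ∈ Finset.univ \ S, -a i ∈ J ⊔ m * I ^ Fintype.card ι := by
    refine sum_mem fun S hS => ?_
    have hS0 : S ≠ ∅ := Finset.ne_of_mem_erase hS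
    obtain ⟨d, hd⟩ := Nat.exists_eq_succ_of_ne_zero (Finset.card_ne_zero.2
      (Finset.nonempty_iff_ne_empty.2 hS0))
    have hb : ∏ i ∈ S, pullback (s i) (a i) ∈ I ^ (d + 1) := by
      rw [← Nat.succ_eq_add_one, ← hd, ← Finset.prod_const]
      exact Ideal.prod_mem_prod fun i _ => hpI _ (hs i).1 _ (ha i)
    have hc : ∏ i ∈ Finset.univ \ S, -a i ∈ I ^ (Finset.univ \ S).card := by
      rw [← Finset.prod_const]
      exact Ideal.prod_mem_prod fun i _ => neg_mem (ha i)
    have h2 := Ideal.mul_mem_mul (htr d _ hb) hc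
    rw [Ideal.sup_mul, mul_assoc, ← pow_add] at h2
    have hcd : d + 1 + (Finset.univ \ S).card = Fintype.card ι := by
      rw [← Nat.succ_eq_add_one, ← hd, add_comm, Finset.card_sdiff_add_card,
        Finset.union_eq_left.2 (Finset.subset_univ S), Finset.card_univ]
    rw [hcd, Finset.sum_mul] at h2
    simp only [map_prod] at h2
    exact sup_le_sup_right Ideal.mul_le_left (m * I ^ Fintype.card ι) h2
  have hlast := (Submodule.add_mem_iff_right _ hrest).1 hsum
  simp only [Finset.prod_empty, one_mul, Finset.sdiff_empty, Finset.sum_const, Finset.prod_neg,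
    Finset.card_univ, nsmul_eq_mul] at hlast
  have hunit : IsUnit ((Fintype.card ι : MvPolynomial (Fin n) ℝ) * (-1) ^ Fintype.card ι) := by
    refine IsUnit.mul ?_ (isUnit_one.neg.pow _)
    rw [← map_natCast (C : ℝ →+* MvPolynomial (Fin n) ℝ)]
    exact (isUnit_iff_ne_zero.2 hcard).map C
  rw [← mul_assoc] at hlast
  exact (Ideal.unit_mul_mem_iff_mem _ hunit).1 hlast

end FiniteImage

section InvariantForm

/-- The spectral theorem for positive definite bilinear forms. -/
lemma iSup_eigenspace_eq_top_of_symmetric {V : Type*} [AddCommGroup V] [Module ℝ V]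
    [FiniteDimensional ℝ V] (B : LinearMap.BilinForm ℝ V) (hsymm : ∀ u v, B u v = B v u)
    (hpos : ∀ u, u ≠ 0 → 0 < B u u) (S : V →ₗ[ℝ] V) (hS : ∀ u v, B (S u) v = B u (S v)) :
    ⨆ c, Module.End.eigenspace S c = ⊤ := by
  let core : InnerProductSpace.Core ℝ V :=
    { inner u v := B u v
      conj_inner_symm u v := hsymm v u
      re_inner_nonneg u := by
        rcases eq_or_ne u 0 with rfl | hu
        · simp
        · exact (hpos u hu).le
      add_left u v x := by simp
      smul_left u v r := by simp
      definite u hu := by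
        by_contra h
        exact (hpos u h).ne' hu }
  let _ : NormedAddCommGroup V := core.toNormedAddCommGroup
  let _ : InnerProductSpace ℝ V := InnerProductSpace.ofCore core.toCore
  have hsym : S.IsSymmetric := hS
  exact Submodule.orthogonal_eq_bot_iff.1 hsym.orthogonalComplement_iSup_eigenspaces_eq_bot

variable {n} {K : Set (Matrix (Fin n) (Fin n) ℝ)} (hK : IsMatSubgroup ℝ n K) (hKc : IsCompact K)
include hK hKc

lemma exists_invariant_form : ∃ B : LinearMap.BilinForm ℝ (Fin n → ℝ),
    (∀ u v, B u v = B v u) ∧ (∀ u, u ≠ 0 → 0 < B u u) ∧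
      ∀ k ∈ K, ∀ u v, B (k.mulVec u) (k.mulVec v) = B u v := by
  obtain ⟨M⟩ := exists_invariantMean hK hKc
  let f : (Fin n → ℝ) → (Fin n → ℝ) → C(K, ℝ) := fun u v =>
    ⟨fun k => (k : Matrix (Fin n) (Fin n) ℝ).mulVec u ⬝ᵥ
      (k : Matrix (Fin n) (Fin n) ℝ).mulVec v,
      ((continuous_mulVec_const u).comp continuous_subtype_val).dotProduct
        ((continuous_mulVec_const v).comp continuous_subtype_val)⟩
  refine ⟨LinearMap.mk₂ ℝ (fun u v => M.mean (f u v)) (fun u u' v => ?_) (fun c u v => ?_)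
    (fun u v v' => ?_) (fun c u v => ?_), fun u v => ?_, fun u hu => ?_, fun k hk u v => ?_⟩
  · have h : f (u + u') v = f u v + f u' v := ContinuousMap.ext fun k => by simp [f, Matrix.mulVec_add]
    exact (congrArg M.mean h).trans (map_add M.mean (f u v) (f u' v))
  · have h : f (c • u) v = c • f u v := ContinuousMap.ext fun k => by simp [f, Matrix.mulVec_smul]
    exact (congrArg M.mean h).trans (map_smul M.mean c (f u v))
  · have h : f u (v + v') = f u v + f u v' := ContinuousMap.ext fun k => by simp [f, Matrix.mulVec_add]
    exact (congrArg M.mean h).trans (map_add M.mean (f u v) (f u v'))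
  · have h : f u (c • v) = c • f u v := ContinuousMap.ext fun k => by simp [f, Matrix.mulVec_smul]
    exact (congrArg M.mean h).trans (map_smul M.mean c (f u v))
  · exact congrArg M.mean (ContinuousMap.ext fun k =>
      dotProduct_comm ((k : Matrix (Fin n) (Fin n) ℝ).mulVec u) _)
  · refine M.mean_pos _ (fun k => ?_) fun h => ?_
    · change 0 ≤ (k : Matrix (Fin n) (Fin n) ℝ).mulVec u ⬝ᵥ (k : Matrix (Fin n) (Fin n) ℝ).mulVec u
      exact Finset.sum_nonneg fun i _ => mul_self_nonneg _
    · have := congrArg (fun g => g ⟨1, hK.1⟩) h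
      exact hu (by simpa [f, dotProduct_self_eq_zero] using this)
  · refine M.mean_mul_right ⟨k, hk⟩ (f u v) _ fun a b hab => ?_
    simp [f, hab, Matrix.mulVec_mulVec]

omit hK hKc in
lemma form_skew_of_mem_lieAlgebra {B : LinearMap.BilinForm ℝ (Fin n → ℝ)}
    (hB : ∀ k ∈ K, ∀ u v, B (k.mulVec u) (k.mulVec v) = B u v)
    {A : Matrix (Fin n) (Fin n) ℝ} (hA : A ∈ lieAlgebra ℝ n K) (u v : Fin n → ℝ) :
    B (A.mulVec u) v = -B u (A.mulVec v) := by
  let B' : (Fin n → ℝ) →L[ℝ] (Fin n → ℝ) →L[ℝ] ℝ :=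
    LinearMap.toContinuousLinearMap (LinearMap.toContinuousLinearMap.toLinearMap ∘ₗ B)
  have hd : ∀ x, HasDerivAt (fun t : ℝ => (mexp ℝ n (t • A)).mulVec x) (A.mulVec x) 0 := fun x =>
    hasDerivAt_pi.2 fun i => hasDerivAt_mexp_mulVec_zero A x i
  have h1 := (B'.hasFDerivAt.comp_hasDerivAt 0 (hd u)).clm_apply (hd v)
  have h2 : (fun t : ℝ => (B' ∘ fun t : ℝ => (mexp ℝ n (t • A)).mulVec u) t
      ((mexp ℝ n (t • A)).mulVec v)) = fun _ => B u v :=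
    funext fun t => hB _ (hA t) u v
  rw [h2] at h1
  have h3 := h1.unique (hasDerivAt_const _ _)
  simp only [Function.comp_apply, zero_smul, mexp_zero, Matrix.one_mulVec] at h3
  exact eq_neg_of_add_eq_zero_left h3

lemma isSliceComplement_orthogonal {B : LinearMap.BilinForm ℝ (Fin n → ℝ)}
    (hsymm : ∀ u v, B u v = B v u) (hpos : ∀ u, u ≠ 0 → 0 < B u u)
    (hB : ∀ k ∈ K, ∀ u v, B (k.mulVec u) (k.mulVec v) = B u v) (w : Fin n → ℝ) :
    IsSliceComplement ℝ n K w (B.orthogonal (orbitTangent ℝ n K w)) := by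
  refine ⟨LinearMap.BilinForm.isCompl_orthogonal_of_restrict_nondegenerate
    (fun u v h => (hsymm v u).trans h) ⟨fun u hu => ?_, fun u hu => ?_⟩, fun k hk x hx => ?_⟩
  · by_contra h
    exact (hpos u (by simpa using h)).ne' (hu u)
  · by_contra h
    exact (hpos u (by simpa using h)).ne' (hu u)
  · rw [LinearMap.BilinForm.mem_orthogonal_iff] at *
    intro t ht
    obtain ⟨l, hl, hkl, -⟩ := (isMatSubgroup_isotropy hK w).exists_inv hk
    have := hx _ (mulVec_mem_orbitTangent hK hKc ht hl)
    have h2 := hB k hk.1 (l.mulVec t) x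
    rwa [Matrix.mulVec_mulVec, hkl, Matrix.one_mulVec, this] at h2

end InvariantForm

section Infinitesimal

variable {n}

lemma derivative_aeval_polynomial {𝔽 : Type*} [Field 𝔽] [Algebra ℝ 𝔽] (y : Fin n → Polynomial 𝔽)
    (p : MvPolynomial (Fin n) ℝ) :
    Polynomial.derivative (aeval y p) =
      ∑ i, aeval y (pderiv i p) * Polynomial.derivative (y i) := by
  induction p using MvPolynomial.induction_on with
  | C a => simp [IsScalarTower.algebraMap_apply ℝ 𝔽 (Polynomial 𝔽)]
  | add p q hp hq => simp only [map_add, hp, hq, add_mul, Finset.sum_add_distrib]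
  | mul_X p j hp =>
    simp only [map_mul, aeval_X, Polynomial.derivative_mul, hp, Derivation.leibniz, smul_eq_mul,
      map_add, add_mul, Finset.sum_add_distrib, Finset.sum_mul]
    rw [add_comm]
    refine congrArg₂ (· + ·) ?_ ?_
    · rw [Finset.sum_eq_single j]
      · simp
      · intro i _ hi; simp [pderiv_X_of_ne hi.symm]
      · simp
    · exact Finset.sum_congr rfl fun i _ => by ring

variable {K : Set (Matrix (Fin n) (Fin n) ℝ)} {w : Fin n → ℝ}

lemma Invariant.sum_pderiv_mul_eq_zero {F : MvPolynomial (Fin n) ℝ} (hF : Invariant ℝ n K F)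
    {A : Matrix (Fin n) (Fin n) ℝ} (hA : A ∈ lieAlgebra ℝ n K) :
    ∑ i, pderiv i F * ∑ j, C (A i j) * X j = 0 := by
  refine MvPolynomial.funext fun x => ?_
  have h1 := hasDerivAt_eval_comp F (hasDerivAt_mexp_mulVec_zero A x)
  simp only [hF _ (hA _), zero_smul, mexp_zero, Matrix.one_mulVec] at h1
  have h3 := h1.unique (hasDerivAt_const _ _)
  rw [dirDeriv_apply] at h3
  rw [map_sum, map_zero]
  simp only [map_mul, map_sum, eval_C, eval_X]
  exact h3

lemma mulVec_eq_zero_of_mem_lieAlgebra_isotropy {A : Matrix (Fin n) (Fin n) ℝ}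
    (hA : A ∈ lieAlgebra ℝ n (isotropy ℝ n K w)) : A.mulVec w = 0 := by
  funext i
  have h1 := hasDerivAt_mexp_mulVec_zero A w i
  simp only [fun t => (hA t).2] at h1
  exact h1.unique (hasDerivAt_const _ _)

lemma orbitTangent_of_complex_eigenvector (hK : IsMatSubgroup ℝ n K) (hKc : IsCompact K)
    (hred : IsAlmostGReduced ℝ n K (orbit ℝ n K w)) {A : Matrix (Fin n) (Fin n) ℝ}
    (hA : A ∈ lieAlgebra ℝ n (isotropy ℝ n K w)) {u v : Fin n → ℝ} {c : ℝ} (hc : c ≠ 0)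
    (hu : A.mulVec u = c • v) (hv : A.mulVec v = -(c • u)) :
    v ∈ orbitTangent ℝ n K w := by
  let z : Fin n → ℂ := fun i => u i + v i * Complex.I
  let y : Fin n → Polynomial ℂ := fun i =>
    Polynomial.C (w i : ℂ) + Polynomial.C (z i) * Polynomial.X
  have hAy : ∀ i, aeval y (∑ j, C (A i j) * X j : MvPolynomial (Fin n) ℝ) =
      Polynomial.C (-(c * Complex.I)) * Polynomial.X * Polynomial.C (z i) := fun i => by
    have h1 : ∑ j, (A i j : ℂ) * w j = 0 := by
      exact_mod_cast congrFun (mulVec_eq_zero_of_mem_lieAlgebra_isotropy hA) i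
    have h2 : ∑ j, (A i j : ℂ) * u j = c * v i := by exact_mod_cast congrFun hu i
    have h3 : ∑ j, (A i j : ℂ) * v j = -(c * u i) := by exact_mod_cast congrFun hv i
    have h4 : ∑ j, (A i j : ℂ) * z j = -(c * Complex.I) * z i := by
      simp only [z, mul_add, Finset.sum_add_distrib, ← mul_assoc, ← Finset.sum_mul, h2, h3]
      linear_combination (c * v i : ℂ) * Complex.I_sq
    have h5 : ∀ j, algebraMap ℝ (Polynomial ℂ) (A i j) = Polynomial.C (A i j : ℂ) := fun j => rfl
    have h6 : ∀ j, aeval y (C (A i j) * X j : MvPolynomial (Fin n) ℝ) =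
        Polynomial.C (A i j * w j : ℂ) + Polynomial.C (A i j * z j) * Polynomial.X := fun j => by
      rw [map_mul, aeval_C, aeval_X, h5, Polynomial.C_mul, Polynomial.C_mul]
      ring
    rw [map_sum, Finset.sum_congr rfl fun j _ => h6 j, Finset.sum_add_distrib, ← Finset.sum_mul,
      ← map_sum, ← map_sum, h1, h4, Polynomial.C_mul, map_zero]
    ring
  have hy : ∀ i, Polynomial.derivative (y i) = Polynomial.C (z i) := fun i => by simp [y]
  have hy0 : ∀ p : MvPolynomial (Fin n) ℝ, (aeval y p).eval 0 = (eval w p : ℂ) := fun p => by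
    induction p using MvPolynomial.induction_on with
    | C a => simp [IsScalarTower.algebraMap_apply ℝ ℂ (Polynomial ℂ)]
    | add p q hp hq => simp [hp, hq]
    | mul_X p i hp => simp [hp, y]
  have hker : invariantIdeal ℝ n K (orbit ℝ n K w) ≤ RingHom.ker (aeval (R := ℝ) y) := by
    refine Ideal.span_le.2 fun F hF => ?_
    have hFw : eval w F = 0 := hF.2 w ⟨1, hK.1, Matrix.one_mulVec w⟩
    have h1 := congrArg (aeval y) (hF.1.sum_pderiv_mul_eq_zero fun t => (hA t).1)
    rw [map_sum, map_zero] at h1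
    simp only [map_mul (aeval y), hAy] at h1
    have h2 : Polynomial.C (-(c * Complex.I)) * Polynomial.X *
        Polynomial.derivative (aeval y F) = 0 := by
      rw [← h1, derivative_aeval_polynomial, Finset.mul_sum]
      exact Finset.sum_congr rfl fun i _ => by rw [hy]; ring
    have h3 : Polynomial.derivative (aeval y F) = 0 := by
      refine (mul_eq_zero.1 h2).resolve_left (mul_ne_zero ?_ Polynomial.X_ne_zero)
      simpa using hc
    have h4 := Polynomial.eq_C_of_natDegree_eq_zero (Polynomial.derivative_eq_zero.1 h3)
    rw [SetLike.mem_coe, RingHom.mem_ker, h4, Polynomial.coeff_zero_eq_eval_zero, hy0, hFw]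
    simp
  rw [mem_orbitTangent_iff_dirDeriv hK hKc]
  intro p hp
  have hpr : p ∈ (invariantIdeal ℝ n K (orbit ℝ n K w)).radical := by rw [hred]; exact hp
  obtain ⟨d, hd⟩ := hpr
  have hp0 : aeval y p = 0 := by
    have := hker hd
    rw [RingHom.mem_ker, map_pow] at this
    exact eq_zero_of_pow_eq_zero this
  have h1 := congrArg (Polynomial.eval 0) (derivative_aeval_polynomial y p)
  rw [hp0] at h1
  simp only [hy, Polynomial.eval_finsetSum, Polynomial.eval_mul, hy0, Polynomial.eval_C,
    Polynomial.derivative_zero, Polynomial.eval_zero] at h1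
  have h2 := congrArg Complex.im h1
  rw [dirDeriv_apply]
  simpa [z] using h2.symm

end Infinitesimal

section Orbits

variable {n}
variable {K : Set (Matrix (Fin n) (Fin n) ℝ)} {w : Fin n → ℝ}

lemma mulVec_mem_orbitTangent_of_isAlmostGReduced (hK : IsMatSubgroup ℝ n K) (hKc : IsCompact K)
    (hred : IsAlmostGReduced ℝ n K (orbit ℝ n K w)) {A : Matrix (Fin n) (Fin n) ℝ}
    (hA : A ∈ lieAlgebra ℝ n (isotropy ℝ n K w)) (x : Fin n → ℝ) :
    A.mulVec x ∈ orbitTangent ℝ n K w := by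
  obtain ⟨B, hsymm, hpos, hB⟩ := exists_invariant_form hK hKc
  have hskew := form_skew_of_mem_lieAlgebra hB (A := A) fun t => (hA t).1
  have htop := iSup_eigenspace_eq_top_of_symmetric B hsymm hpos (A.mulVecLin ∘ₗ A.mulVecLin)
    fun u v => by
      rw [LinearMap.comp_apply, LinearMap.comp_apply, Matrix.mulVecLin_apply, hskew]
      exact (congrArg Neg.neg (hskew _ _)).trans (neg_neg _)
  suffices h : (⊤ : Submodule ℝ (Fin n → ℝ)) ≤ (orbitTangent ℝ n K w).comap A.mulVecLin from
    h Submodule.mem_top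
  rw [← htop]
  refine iSup_le fun ν u hu => ?_
  have hu2 : A.mulVec (A.mulVec u) = ν • u := by
    simpa using Module.End.mem_eigenspace_iff.1 hu
  change A.mulVec u ∈ orbitTangent ℝ n K w
  rcases eq_or_ne (A.mulVec u) 0 with h0 | h0
  · rw [h0]
    exact Submodule.zero_mem _
  have hu0 : u ≠ 0 := fun h => h0 (by rw [h, Matrix.mulVec_zero])
  have hν : ν < 0 := by
    have h1 := hskew (A.mulVec u) u
    rw [hu2, map_smul, LinearMap.smul_apply, smul_eq_mul] at h1
    nlinarith [hpos u hu0, hpos _ h0]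
  set c := Real.sqrt (-ν)
  have hc : c ≠ 0 := (Real.sqrt_pos.2 (neg_pos.2 hν)).ne'
  have hcc : c * c = -ν := Real.mul_self_sqrt (neg_pos.2 hν).le
  have hAu : A.mulVec u = c • (c⁻¹ • A.mulVec u) := by rw [smul_inv_smul₀ hc]
  rw [hAu]
  refine Submodule.smul_mem _ c (orbitTangent_of_complex_eigenvector hK hKc hred hA hc hAu ?_)
  rw [Matrix.mulVec_smul, hu2, smul_smul, ← neg_smul]
  congr 1
  field_simp
  linarith

lemma dirDeriv_mulVec_sub_eq_zero {k : Matrix (Fin n) (Fin n) ℝ} (hK : IsMatSubgroup ℝ n K)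
    (hk : k ∈ isotropy ℝ n K w) (u : Fin n → ℝ) {p : MvPolynomial (Fin n) ℝ}
    (hp : p ∈ invariantIdeal ℝ n K (orbit ℝ n K w)) : dirDeriv w (k.mulVec u - u) p = 0 := by
  induction hp using Submodule.span_induction with
  | mem p hp =>
    have h1 := dirDeriv_pullback k w u p
    rw [hp.1.pullback_eq hk.1, hk.2] at h1
    rw [dirDeriv_sub_right, h1, sub_self]
  | zero => exact map_zero _
  | add p q _ _ hp hq => rw [map_add, hp, hq, add_zero]
  | smul a p hpI hp =>
    have h0 : eval w p = 0 := (mem_vanishingIdeal_orbit.1 (invariantIdeal_le w hpI) 1 hK.1) |>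
      (by simpa using ·)
    rw [smul_eq_mul, dirDeriv_mul, hp, h0, mul_zero, zero_mul, add_zero]

theorem isPrincipalPt_of_isGReduced (hK : IsMatSubgroup ℝ n K) (hKc : IsCompact K)
    (hred : IsGReduced ℝ n K (orbit ℝ n K w)) : IsPrincipalPt ℝ n K w := by
  obtain ⟨B, hsymm, hpos, hB⟩ := exists_invariant_form hK hKc
  have hN := isSliceComplement_orthogonal hK hKc hsymm hpos hB w
  refine ⟨hasClosedOrbit hK hKc w, _, hN, fun k hk u hu => ?_⟩
  refine sub_eq_zero.1 (Submodule.disjoint_def.1 hN.1.disjoint _ ?_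
    (Submodule.sub_mem _ (hN.2 k hk u hu) hu))
  refine (mem_orbitTangent_iff_dirDeriv hK hKc).2 fun p hp =>
    dirDeriv_mulVec_sub_eq_zero hK hk u ?_
  rw [hred]
  exact hp

lemma isMatSubgroup_pointwise_fixer (hK : IsMatSubgroup ℝ n K) (N : Set (Fin n → ℝ)) :
    IsMatSubgroup ℝ n {k ∈ K | ∀ x ∈ N, k.mulVec x = x} := by
  refine ⟨⟨hK.1, fun x _ => Matrix.one_mulVec x⟩, fun a ha b hb => ⟨hK.2.1 a ha.1 b hb.1,
    fun x hx => ?_⟩, fun a ha => ⟨(hK.2.2 a ha.1).1, (hK.2.2 a ha.1).2, fun x hx => ?_⟩⟩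
  · rw [← Matrix.mulVec_mulVec, hb.2 x hx, ha.2 x hx]
  · have hdet := (Matrix.isUnit_iff_isUnit_det a).1 (hK.2.2 a ha.1).1
    conv_lhs => rw [← ha.2 x hx]
    rw [Matrix.mulVec_mulVec, Matrix.nonsing_inv_mul a hdet, Matrix.one_mulVec]

lemma isClosed_pointwise_fixer (hKc : IsCompact K) (N : Set (Fin n → ℝ)) :
    IsClosed {k ∈ K | ∀ x ∈ N, k.mulVec x = x} := by
  have h : {k ∈ K | ∀ x ∈ N, k.mulVec x = x} =
      K ∩ ⋂ x ∈ N, {k : Matrix (Fin n) (Fin n) ℝ | k.mulVec x = x} := by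
    ext k
    simp
  rw [h]
  exact hKc.isClosed.inter (isClosed_biInter fun x _ =>
    isClosed_eq (continuous_mulVec_const x) continuous_const)

lemma exists_mem_lieAlgebra_of_not_hasFiniteImageOn (hK : IsMatSubgroup ℝ n K)
    (hKc : IsCompact K) {N : Submodule ℝ (Fin n → ℝ)} (h : ¬HasFiniteImageOn ℝ n K N) :
    ∃ A ∈ lieAlgebra ℝ n K, ∃ x ∈ N, A.mulVec x ≠ 0 := by
  let e := Set.Infinite.natEmbedding _ h
  choose s hsK hs using fun j => (e j).2
  have hinj : ∀ i j, (∀ x ∈ N, (s i).mulVec x = (s j).mulVec x) → i = j := fun i j hij => by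
    refine e.injective (Subtype.ext ?_)
    rw [← hs i, ← hs j]
    exact funext fun x => hij x x.2
  have : FirstCountableTopology (Matrix (Fin n) (Fin n) ℝ) :=
    inferInstanceAs (FirstCountableTopology (Fin n → Fin n → ℝ))
  obtain ⟨a, ha, φ, hφ, hlim⟩ := hKc.tendsto_subseq hsK
  obtain ⟨b, hb, hab, hba⟩ := hK.exists_inv ha
  let H := {k ∈ K | ∀ x ∈ (N : Set (Fin n → ℝ)), k.mulVec x = x}
  have hgH : ∃ m, ∀ j, b * s (φ (j + m)) ∉ H := by
    have key : ∀ i j, b * s (φ i) ∈ H → b * s (φ j) ∈ H → i = j := fun i j hi hj => by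
      refine hφ.injective (hinj _ _ fun x hx => ?_)
      have h1 : (b * s (φ i)).mulVec x = (b * s (φ j)).mulVec x :=
        (hi.2 x hx).trans (hj.2 x hx).symm
      have h2 := congrArg a.mulVec h1
      rwa [Matrix.mulVec_mulVec, Matrix.mulVec_mulVec, ← mul_assoc, ← mul_assoc, hab, one_mul,
        one_mul] at h2
    by_cases hex : ∃ i, b * s (φ i) ∈ H
    · obtain ⟨i, hi⟩ := hex
      refine ⟨i + 1, fun j hj => ?_⟩
      have := key _ _ hi hj
      omega
    · exact ⟨0, fun j hj => hex ⟨_, hj⟩⟩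
  obtain ⟨m, hm⟩ := hgH
  have hlim1 : Tendsto (fun j => b * s (φ (j + m))) atTop (𝓝 1) := by
    rw [← hba]
    exact ((tendsto_add_atTop_iff_nat m).2 hlim).const_mul b
  obtain ⟨-, -, -, A, -, -, -, -, -, hAK, hAH⟩ := matrix_exists_tangent_direction hK hKc
    (isMatSubgroup_pointwise_fixer hK N) (fun k hk => hk.1) (isClosed_pointwise_fixer hKc N)
    (fun j => hK.2.1 b hb _ (hsK (φ (j + m)))) hm
    (isMatSubgroup_pointwise_fixer hK (N : Set (Fin n → ℝ))).1 hlim1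
  refine ⟨A, hAK, ?_⟩
  by_contra! hA
  exact hAH fun t => ⟨hAK t, fun x hx => mexp_smul_mulVec_eq_self (hA x hx) t⟩

theorem isAlmostPrincipalPt_of_isAlmostGReduced (hK : IsMatSubgroup ℝ n K) (hKc : IsCompact K)
    (hred : IsAlmostGReduced ℝ n K (orbit ℝ n K w)) : IsAlmostPrincipalPt ℝ n K w := by
  obtain ⟨B, hsymm, hpos, hB⟩ := exists_invariant_form hK hKc
  have hN := isSliceComplement_orthogonal hK hKc hsymm hpos hB w
  refine ⟨hasClosedOrbit hK hKc w, _, hN, ?_⟩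
  by_contra hinf
  obtain ⟨A, hA, x, hx, hAx⟩ := exists_mem_lieAlgebra_of_not_hasFiniteImageOn
    (isMatSubgroup_isotropy hK w) (isCompact_isotropy hKc w) hinf
  have hT := mulVec_mem_orbitTangent_of_isAlmostGReduced hK hKc hred hA
  refine hAx (Submodule.disjoint_def.1 hN.1.disjoint _ (hT x) ?_)
  rw [LinearMap.BilinForm.mem_orthogonal_iff] at *
  intro t ht
  have h1 := form_skew_of_mem_lieAlgebra hB (A := A) (fun t => (hA t).1) t x
  have h2 : B (A.mulVec t) x = 0 := hx _ (hT t)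
  exact neg_eq_zero.1 (h1.symm.trans h2)

theorem isGReduced_of_isPrincipalPt (hK : IsMatSubgroup ℝ n K) (hKc : IsCompact K)
    (h : IsPrincipalPt ℝ n K w) : IsGReduced ℝ n K (orbit ℝ n K w) := by
  obtain ⟨-, N, hN, htriv⟩ := h
  refine le_antisymm (invariantIdeal_le w) ?_
  have h1 : (1 : Matrix (Fin n) (Fin n) ℝ) ∈ isotropy ℝ n K w := (isMatSubgroup_isotropy hK w).1
  have := vanishingIdeal_pow_le hK hKc hN (s := fun _ : Unit => 1) (fun _ => h1)
    fun k hk => ⟨(), fun x hx => by rw [htriv k hk x hx, Matrix.one_mulVec], fun _ _ => rfl⟩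
  rwa [Fintype.card_unit, pow_one] at this

theorem isAlmostGReduced_of_isAlmostPrincipalPt (hK : IsMatSubgroup ℝ n K) (hKc : IsCompact K)
    (h : IsAlmostPrincipalPt ℝ n K w) : IsAlmostGReduced ℝ n K (orbit ℝ n K w) := by
  obtain ⟨-, N, hN, hfin⟩ := h
  have := Set.Finite.fintype hfin
  choose s hs hsval using fun f : (fun k => fun x : N => Matrix.mulVec k (x : Fin n → ℝ)) ''
    isotropy ℝ n K w => f.2
  have hpow := vanishingIdeal_pow_le hK hKc hN hs fun k hk =>
    ⟨⟨_, k, hk, rfl⟩, fun x hx => (congrFun (hsval ⟨_, k, hk, rfl⟩) ⟨x, hx⟩).symm, fun f hf =>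
      Subtype.ext ((hsval f).symm.trans (funext fun x => (hf x x.2).symm))⟩
  refine le_antisymm (fun p ⟨d, hd⟩ x hx => ?_) fun p hp => ⟨_, hpow (Ideal.pow_mem_pow hp _)⟩
  have h0 := invariantIdeal_le w hd x hx
  rw [map_pow] at h0
  exact eq_zero_of_pow_eq_zero h0

end Orbits

/-- **Theorem 1.2.** Let `K` be a compact Lie group (realized as a compact subgroup of
`GL_n(ℝ)`) and `w ∈ W = ℝⁿ`.  The orbit `Kw` is `K`-reduced if and only if it is principal,
and `Kw` is almost `K`-reduced if and only if it is almost principal. -/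
theorem orbit_K_reduced_iff_principal
    (n : ℕ) (K : Set (Matrix (Fin n) (Fin n) ℝ))
    (hKgrp : IsMatSubgroup ℝ n K) (hKcpt : IsCompact K) (w : Fin n → ℝ) :
    (IsGReduced ℝ n K (orbit ℝ n K w) ↔ IsPrincipalPt ℝ n K w) ∧
    (IsAlmostGReduced ℝ n K (orbit ℝ n K w) ↔ IsAlmostPrincipalPt ℝ n K w) :=
  ⟨⟨isPrincipalPt_of_isGReduced hKgrp hKcpt, isGReduced_of_isPrincipalPt hKgrp hKcpt⟩,
    isAlmostPrincipalPt_of_isAlmostGReduced hKgrp hKcpt,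
    isAlmostGReduced_of_isAlmostPrincipalPt hKgrp hKcpt⟩

end ZPaper
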